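/- There exist constants c > 0, C and a real number x₀ such that for all real x ≥ x₀, | ∑_{n ≤ x} λ(n)/n | ≤ C exp(−c √(log x)), where λ is the Liouville function. -/

import Mathlib

/-- The Liouville function `λ(n) = (-1)^{Ω(n)}` (as a real-valued function). -/
noncomputable def liouville (n : ℕ) : ℝ := (-1) ^ (ArithmeticFunction.cardFactors n)

section

open Complex Metric Set

/-- A bounded nonvanishing function on a disc has a logarithm controlled by Borel–Carathéodory. -/
lemma exists_log_norm_le {f : ℂ → ℂ} {r M : ℝ} (hr : 0 < r) (hM : 0 < M)
    (hf : DifferentiableOn ℂ f (ball 0 r)) (h0 : ∀ z ∈ ball (0 : ℂ) r, f z ≠ 0)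
    (hb : ∀ z ∈ ball (0 : ℂ) r, ‖f z‖ ≤ Real.exp M * ‖f 0‖) :
    ∃ g : ℂ → ℂ, DifferentiableOn ℂ g (ball 0 r) ∧ (∀ z ∈ ball (0 : ℂ) r, f z = f 0 * exp (g z)) ∧
      deriv g 0 = deriv f 0 / f 0 ∧ ∀ z ∈ ball (0 : ℂ) r, ‖g z‖ ≤ 2 * M * ‖z‖ / (r - ‖z‖) := by
  have hmem : (0 : ℂ) ∈ ball (0 : ℂ) r := mem_ball_self hr
  have hlog : DifferentiableOn ℂ (fun z => deriv f z / f z) (ball 0 r) :=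
    (hf.deriv isOpen_ball).div hf h0
  obtain ⟨g, hg0, hg⟩ := hlog.isExactOn_ball.with_val_at 0 0
  have hgd : DifferentiableOn ℂ g (ball 0 r) :=
    fun z hz => (hg z hz).differentiableAt.differentiableWithinAt
  have hfg : ∀ z ∈ ball (0 : ℂ) r, f z = f 0 * exp (g z) := by
    have hd : ∀ z ∈ ball (0 : ℂ) r, HasDerivAt (fun w => f w * exp (-g w)) 0 z := by
      intro z hz
      have h1 : HasDerivAt (fun w => f w * exp (-g w))
          (deriv f z * exp (-g z) + f z * (exp (-g z) * -(deriv f z / f z))) z :=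
        ((hf.differentiableAt (isOpen_ball.mem_nhds hz)).hasDerivAt).mul (hg z hz).neg.cexp
      have h2 : deriv f z * exp (-g z) + f z * (exp (-g z) * -(deriv f z / f z)) = 0 := by
        have := h0 z hz
        field_simp
        ring
      rwa [h2] at h1
    intro z hz
    have := (isOpen_ball (x := (0 : ℂ)) (ε := r)).is_const_of_deriv_eq_zero
      (convex_ball 0 r).isPreconnected
      (fun w hw => (hd w hw).differentiableAt.differentiableWithinAt)
      (fun w hw => (hd w hw).deriv) hz hmem
    simp only [hg0, neg_zero, Complex.exp_zero, mul_one] at this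
    rw [← this, mul_assoc, ← Complex.exp_add]
    simp
  refine ⟨g, hgd, hfg, (hg 0 hmem).deriv, fun z hz => ?_⟩
  refine borelCaratheodory_zero hM hgd (fun w hw => ?_) hr hz hg0
  have h1 := hb w hw
  rw [hfg w hw, norm_mul, mul_comm, Complex.norm_exp] at h1
  have h2 := le_of_mul_le_mul_right h1 (norm_pos_iff.mpr (h0 0 hmem))
  exact Real.exp_le_exp.mp h2

/-- Division of a zero by the corresponding Blaschke factor. -/
lemma exists_blaschke_division {f : ℂ → ℂ} (hf : Differentiable ℂ f) {R : ℝ} (hR : 0 < R) {ρ : ℂ}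
    (hρ : f ρ = 0) :
    ∃ g : ℂ → ℂ, Differentiable ℂ g ∧
      ∀ z, g z * ((z - ρ) * R) = f z * (R ^ 2 - (starRingEnd ℂ) ρ * z) := by
  refine ⟨fun z => dslope f ρ z * (R ^ 2 - (starRingEnd ℂ) ρ * z) / R, ?_, fun z => ?_⟩
  · have : Differentiable ℂ (dslope f ρ) := by
      rw [← differentiableOn_univ] at hf ⊢
      exact (Complex.differentiableOn_dslope Filter.univ_mem).mpr hf
    fun_prop
  · have h := sub_smul_dslope f ρ z
    rw [hρ, sub_zero, smul_eq_mul] at h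
    have : (R : ℂ) ≠ 0 := by exact_mod_cast hR.ne'
    rw [← h]
    field_simp

lemma blaschke_division_properties {f g : ℂ → ℂ} (hf : Differentiable ℂ f)
    (hg : Differentiable ℂ g) {R M : ℝ} (hR : 0 < R) {ρ : ℂ} (hρ : f ρ = 0) (hρR : ‖ρ‖ ≤ R / 2)
    (hf0 : f 0 ≠ 0) (hb : ∀ z ∈ closedBall (0 : ℂ) R, ‖f z‖ ≤ Real.exp M * ‖f 0‖)
    (h : ∀ z, g z * ((z - ρ) * R) = f z * (R ^ 2 - (starRingEnd ℂ) ρ * z)) :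
    2 * ‖f 0‖ ≤ ‖g 0‖ ∧ (∀ z ∈ closedBall (0 : ℂ) R, ‖g z‖ ≤ Real.exp M * ‖f 0‖) ∧
      (deriv f 0 / f 0 = deriv g 0 / g 0 - 1 / ρ + (starRingEnd ℂ) ρ / R ^ 2) ∧
      (∀ z ∈ closedBall (0 : ℂ) (R / 2), g z = 0 → f z = 0) := by
  have hρ0 : ρ ≠ 0 := by rintro rfl; exact hf0 hρ
  have hρn : 0 < ‖ρ‖ := norm_pos_iff.mpr hρ0
  have hRc : (R : ℂ) ≠ 0 := by exact_mod_cast hR.ne'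
  have hg0 : g 0 * ρ = - (f 0 * R) := by
    have := h 0
    apply mul_right_cancel₀ hRc
    linear_combination -this
  have hg0n : ‖g 0‖ * ‖ρ‖ = ‖f 0‖ * R := by
    rw [← norm_mul, hg0, norm_neg, norm_mul]; simp [abs_of_pos hR]
  have hf0n : 0 < ‖f 0‖ := norm_pos_iff.mpr hf0
  have hg0' : g 0 ≠ 0 := by
    intro h0; rw [h0] at hg0n; simp at hg0n; rcases hg0n with h | h
    · exact hf0 h
    · exact hR.ne' h
  have hz : ∀ z ∈ closedBall (0 : ℂ) (R / 2), (R : ℂ) ^ 2 - (starRingEnd ℂ) ρ * z ≠ 0 := by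
    intro z hz h0
    have hz' : ‖z‖ ≤ R / 2 := by simpa using hz
    have h1 : (R : ℂ) ^ 2 = (starRingEnd ℂ) ρ * z := by linear_combination h0
    have h2 : R ^ 2 = ‖ρ‖ * ‖z‖ := by
      have := congrArg norm h1
      simpa [abs_of_pos hR] using this
    have h3 : ‖ρ‖ * ‖z‖ ≤ R / 2 * (R / 2) := by gcongr
    nlinarith
  refine ⟨?_, ?_, ?_, ?_⟩
  · have : 2 * ‖f 0‖ * ‖ρ‖ ≤ ‖g 0‖ * ‖ρ‖ := by rw [hg0n]; nlinarith
    exact le_of_mul_le_mul_right this hρn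
  · have hsph : ∀ z ∈ sphere (0 : ℂ) R, ‖g z‖ ≤ Real.exp M * ‖f 0‖ := by
      intro z hz
      have hzn : ‖z‖ = R := by simpa using hz
      have h1 : ‖(R : ℂ) ^ 2 - (starRingEnd ℂ) ρ * z‖ = R * ‖z - ρ‖ := by
        have : (R : ℂ) ^ 2 = (starRingEnd ℂ) z * z := by
          rw [← normSq_eq_conj_mul_self, normSq_eq_norm_sq, hzn]; push_cast; rfl
        rw [this, ← sub_mul, norm_mul, ← map_sub, norm_conj, hzn, mul_comm]
      have h2 := congrArg norm (h z)
      rw [norm_mul, norm_mul, norm_mul, h1, norm_real, Real.norm_eq_abs, abs_of_pos hR] at h2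
      have h3 : 0 < ‖z - ρ‖ := by
        have : ‖z‖ ≤ ‖z - ρ‖ + ‖ρ‖ := by simpa using norm_add_le (z - ρ) ρ
        linarith
      have h4 : ‖g z‖ = ‖f z‖ := by
        apply mul_right_cancel₀ (mul_pos h3 hR).ne'
        rw [h2]; ring
      rw [h4]
      exact hb z (sphere_subset_closedBall hz)
    intro z hz
    rw [← closure_ball (0 : ℂ) hR.ne'] at hz
    refine Complex.norm_le_of_forall_mem_frontier_norm_le isBounded_ball hg.diffContOnCl ?_ hz
    rw [frontier_ball (0 : ℂ) hR.ne']
    exact hsph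
  · have h1 : HasDerivAt (fun z => g z * ((z - ρ) * R)) (deriv g 0 * ((0 - ρ) * R) + g 0 * (1 * R)) 0 :=
      hg.differentiableAt.hasDerivAt.mul (((hasDerivAt_id (0 : ℂ)).sub_const ρ).mul_const (R : ℂ))
    have h2 : HasDerivAt (fun z => f z * (R ^ 2 - (starRingEnd ℂ) ρ * z))
        (deriv f 0 * (R ^ 2 - (starRingEnd ℂ) ρ * 0) + f 0 * (-((starRingEnd ℂ) ρ * 1))) 0 :=
      hf.differentiableAt.hasDerivAt.mul
        (((hasDerivAt_id (0 : ℂ)).const_mul ((starRingEnd ℂ) ρ)).const_sub ((R : ℂ) ^ 2))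
    have h3 := h1.unique (by rw [funext h]; exact h2)
    have h4 : f 0 = -(g 0 * ρ) / R := by field_simp; linear_combination hg0
    have h5 : deriv f 0 * R ^ 2 = -(deriv g 0 * ρ * R) + g 0 * R + f 0 * (starRingEnd ℂ) ρ := by
      linear_combination -h3
    have h6 : deriv f 0 = (-(deriv g 0 * ρ * R) + g 0 * R + f 0 * (starRingEnd ℂ) ρ) / R ^ 2 := by
      field_simp; linear_combination h5
    rw [h6, h4]
    field_simp
    ring
  · intro z hzm hgz
    have := h z
    rw [hgz, zero_mul] at this
    exact (mul_eq_zero.mp this.symm).resolve_right (hz z hzm)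

/-- If the zeros of `f` near the centre of a disc lie in the left half-plane, then the logarithmic
derivative of `f` at the centre is bounded below in terms of the growth of `f`. -/
lemma neg_re_logDeriv_le {R : ℝ} (hR : 0 < R) (n : ℕ) :
    ∀ (f : ℂ → ℂ) (M : ℝ), Differentiable ℂ f → f 0 ≠ 0 → 0 ≤ M → M < n * Real.log 2 →
      (∀ z ∈ closedBall (0 : ℂ) R, ‖f z‖ ≤ Real.exp M * ‖f 0‖) →
      (∀ z ∈ closedBall (0 : ℂ) (R / 2), f z = 0 → z.re ≤ 0) →
      -(deriv f 0 / f 0).re ≤ 8 * (M + 1) / R := by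
  induction n with
  | zero => intro f M _ _ h1 h2; simp at h2; linarith
  | succ n ih =>
    intro f M hf hf0 hM hMn hb hz
    by_cases hex : ∃ ρ ∈ closedBall (0 : ℂ) (R / 2), f ρ = 0
    · obtain ⟨ρ, hρm, hρ⟩ := hex
      have hρR : ‖ρ‖ ≤ R / 2 := by simpa using hρm
      obtain ⟨g, hg, hgf⟩ := exists_blaschke_division hf hR hρ
      obtain ⟨h1, h2, h3, h4⟩ := blaschke_division_properties hf hg hR hρ hρR hf0 hb hgf
      have hf0n : 0 < ‖f 0‖ := norm_pos_iff.mpr hf0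
      have hlog2 : Real.exp (Real.log 2) = 2 := Real.exp_log two_pos
      have hM2 : Real.log 2 ≤ M := by
        have := h2 0 (by simp [hR.le])
        rw [← Real.exp_le_exp, hlog2]
        exact le_of_mul_le_mul_right (h1.trans this) hf0n
      have key := ih g (M - Real.log 2) hg (by intro h0; rw [h0, norm_zero] at h1; linarith)
        (by linarith) (by push_cast at hMn; linarith)
        (fun z hz' => by
          refine (h2 z hz').trans ?_
          rw [Real.exp_sub, hlog2]
          have := mul_le_mul_of_nonneg_left h1 (Real.exp_pos M).le
          linarith) (fun z hz' h0 => hz z hz' (h4 z hz' h0))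
      have hre : ρ.re ≤ 0 := hz ρ hρm hρ
      have hρ0 : ρ ≠ 0 := by rintro rfl; exact hf0 hρ
      have hterm : 0 ≤ (-(1 / ρ) + (starRingEnd ℂ) ρ / R ^ 2).re := by
        have hn : 0 < normSq ρ := normSq_pos.mpr hρ0
        have hle : normSq ρ ≤ R ^ 2 := by
          rw [normSq_eq_norm_sq]; gcongr; linarith
        have e1 : (starRingEnd ℂ) ρ / (R : ℂ) ^ 2 = (starRingEnd ℂ) ρ / ((R ^ 2 : ℝ) : ℂ) := by
          push_cast; rfl
        rw [e1, add_re, neg_re, one_div, inv_re, div_ofReal_re, conj_re]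
        have : ρ.re / normSq ρ ≤ ρ.re / R ^ 2 := by
          rw [div_le_div_iff₀ hn (by positivity)]
          exact mul_le_mul_of_nonpos_left hle hre
        linarith
      have hle : 8 * (M - Real.log 2 + 1) / R ≤ 8 * (M + 1) / R := by
        have := Real.log_pos one_lt_two
        gcongr; linarith
      have e2 : (deriv f 0 / f 0).re = (deriv g 0 / g 0).re
          + (-(1 / ρ) + (starRingEnd ℂ) ρ / R ^ 2).re := by
        rw [h3, ← add_re]; congr 1; ring
      linarith
    · push Not at hex
      obtain ⟨g, hgd, -, hg', hgb⟩ := exists_log_norm_le (r := R / 2) (M := M + 1) (by linarith)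
        (by linarith) hf.differentiableOn
        (fun z hz' => hex z (ball_subset_closedBall hz'))
        (fun z hz' => (hb z (closedBall_subset_closedBall (by linarith)
          (ball_subset_closedBall hz'))).trans (by gcongr; linarith))
      have := Complex.norm_deriv_le_of_forall_mem_sphere_norm_le (c := 0) (R := R / 4)
        (C := 2 * (M + 1)) (f := g) (by linarith)
        (DifferentiableOn.diffContOnCl (by
          rw [closure_ball (0 : ℂ) (by linarith)]
          exact hgd.mono (closedBall_subset_ball (by linarith))))
        (fun z hz' => by
          have hzn : ‖z‖ = R / 4 := by simpa using hz'
          have := hgb z (by simp [hzn]; linarith)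
          rw [hzn] at this
          refine this.trans (le_of_eq ?_)
          field_simp
          ring)
      rw [hg'] at this
      have h2 := (abs_le.mp (abs_re_le_norm (deriv f 0 / f 0))).1
      have h3 : 2 * (M + 1) / (R / 4) = 8 * (M + 1) / R := by field_simp; ring
      linarith

/-- The variant of `neg_re_logDeriv_le` which retains the contribution of one negative real zero. -/
lemma neg_re_logDeriv_le_sub {R M x : ℝ} (hR : 0 < R) {f : ℂ → ℂ} (hf : Differentiable ℂ f)
    (hf0 : f 0 ≠ 0) (hM : 0 ≤ M)
    (hb : ∀ z ∈ closedBall (0 : ℂ) R, ‖f z‖ ≤ Real.exp M * ‖f 0‖)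
    (hz : ∀ z ∈ closedBall (0 : ℂ) (R / 2), f z = 0 → z.re ≤ 0)
    (hx : 0 < x) (hxR : x ≤ R / 2) (hfx : f (-x) = 0) :
    -(deriv f 0 / f 0).re ≤ 8 * (M + 1) / R - 1 / x + x / R ^ 2 := by
  have hρR : ‖(-x : ℂ)‖ ≤ R / 2 := by simpa [abs_of_pos hx] using hxR
  obtain ⟨g, hg, hgf⟩ := exists_blaschke_division hf hR hfx
  obtain ⟨h1, h2, h3, h4⟩ := blaschke_division_properties hf hg hR hfx hρR hf0 hb hgf
  have hf0n : 0 < ‖f 0‖ := norm_pos_iff.mpr hf0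
  obtain ⟨n, hn⟩ := exists_nat_gt (M / Real.log 2)
  have key := neg_re_logDeriv_le hR n g M hg (by intro h0; rw [h0, norm_zero] at h1; linarith) hM
    ((div_lt_iff₀ (Real.log_pos one_lt_two)).mp hn)
    (fun z hz' => (h2 z hz').trans (by gcongr; linarith)) (fun z hz' h0 => hz z hz' (h4 z hz' h0))
  have e : (deriv f 0 / f 0).re = (deriv g 0 / g 0).re + (1 / x - x / R ^ 2) := by
    rw [h3, show deriv g 0 / g 0 - 1 / (-x : ℂ) + (starRingEnd ℂ) (-x : ℂ) / R ^ 2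
      = deriv g 0 / g 0 + ((1 / x - x / R ^ 2 : ℝ) : ℂ) by
        simp [div_eq_mul_inv]; ring, add_re, ofReal_re]
  linarith

end

section

open Complex Set

/-- The entire function `s ζ(1 + s)`. -/
noncomputable def shiftedZeta : ℂ → ℂ := Function.update (fun s => s * riemannZeta (1 + s)) 0 1

lemma shiftedZeta_apply {s : ℂ} (hs : s ≠ 0) : shiftedZeta s = s * riemannZeta (1 + s) :=
  Function.update_of_ne hs _ _

lemma shiftedZeta_zero : shiftedZeta 0 = 1 := Function.update_self _ _ _

lemma shiftedZeta_eventuallyEq {s : ℂ} (hs : s ≠ 0) :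
    shiftedZeta =ᶠ[nhds s] fun s => s * riemannZeta (1 + s) := by
  filter_upwards [isOpen_ne.mem_nhds hs] with t ht using shiftedZeta_apply ht

lemma differentiable_shiftedZeta : Differentiable ℂ shiftedZeta := by
  have hd : ∀ s : ℂ, s ≠ 0 → DifferentiableAt ℂ shiftedZeta s := by
    intro s hs
    refine DifferentiableAt.congr_of_eventuallyEq ?_ (shiftedZeta_eventuallyEq hs)
    exact differentiableAt_id.mul ((differentiableAt_riemannZeta (by simpa using hs)).comp s
      (by fun_prop))
  intro s
  by_cases hs : s = 0
  · subst hs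
    refine (Complex.analyticAt_of_differentiable_on_punctured_nhds_of_continuousAt
      (eventually_nhdsWithin_of_forall hd) ?_).differentiableAt
    rw [shiftedZeta, continuousAt_update_same]
    have h1 : Filter.Tendsto (fun s : ℂ => 1 + s) (nhdsWithin 0 {0}ᶜ) (nhdsWithin 1 {1}ᶜ) := by
      refine tendsto_nhdsWithin_of_tendsto_nhds_of_eventually_within _ ?_ ?_
      · have : Filter.Tendsto (fun s : ℂ => 1 + s) (nhds 0) (nhds (1 + 0)) :=
          (continuous_const.add continuous_id).tendsto 0
        rw [add_zero] at this
        exact this.mono_left nhdsWithin_le_nhds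
      · exact eventually_nhdsWithin_of_forall fun s hs => by simpa using hs
    simpa [Function.comp_def] using riemannZeta_residue_one.comp h1
  · exact hd s hs

lemma shiftedZeta_ne_zero {s : ℂ} (hs : 0 ≤ s.re) : shiftedZeta s ≠ 0 := by
  by_cases h : s = 0
  · rw [h, shiftedZeta_zero]; exact one_ne_zero
  · rw [shiftedZeta_apply h]
    exact mul_ne_zero h (riemannZeta_ne_zero_of_one_le_re (by simpa using hs))

/-- The fractional part, cut off to the half-line `t > 1`. -/
noncomputable def cutFract (t : ℝ) : ℂ := indicator (Ioi 1) (fun t : ℝ => ((Int.fract t : ℝ) : ℂ)) t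

lemma norm_cutFract_le (t : ℝ) : ‖cutFract t‖ ≤ 1 := by
  unfold cutFract
  by_cases h : t ∈ Ioi (1 : ℝ)
  · rw [indicator_of_mem h, norm_real, Real.norm_eq_abs, abs_of_nonneg (Int.fract_nonneg t)]
    exact (Int.fract_lt_one t).le
  · rw [indicator_of_notMem h]; simp

lemma measurable_cutFract : Measurable cutFract :=
  (measurable_ofReal.comp measurable_fract).indicator measurableSet_Ioi

lemma differentiableAt_mellin_cutFract {s : ℂ} (hs : s.re < 0) :
    DifferentiableAt ℂ (mellin cutFract) s := by
  refine mellin_differentiableAt_of_isBigO_rpow (a := 0) (b := s.re - 1) ?_ ?_ hs ?_ (by linarith)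
  · refine MeasureTheory.LocallyIntegrable.locallyIntegrableOn ?_ _
    refine (MeasureTheory.locallyIntegrable_const (1 : ℝ)).mono
      measurable_cutFract.aestronglyMeasurable ?_
    exact Filter.Eventually.of_forall fun t => by simpa using norm_cutFract_le t
  · refine Asymptotics.IsBigO.of_bound 1 (Filter.Eventually.of_forall fun t => ?_)
    simpa using norm_cutFract_le t
  · refine Asymptotics.IsBigO.of_bound 1 ?_
    have : Iio (1 : ℝ) ∈ nhdsWithin (0 : ℝ) (Ioi 0) :=
      nhdsWithin_le_nhds (Iio_mem_nhds one_pos)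
    filter_upwards [this] with t ht
    rw [cutFract, indicator_of_notMem (by simpa using le_of_lt ht)]
    simp only [norm_zero]
    positivity

lemma mellin_cutFract (s : ℂ) :
    mellin cutFract s = ∫ t in Ioi (1 : ℝ), ((Int.fract t : ℝ) : ℂ) * (t : ℂ) ^ (s - 1) := by
  have h1 : (fun t : ℝ => (t : ℂ) ^ (s - 1) • cutFract t)
      = indicator (Ioi 1) (fun t : ℝ => ((Int.fract t : ℝ) : ℂ) * (t : ℂ) ^ (s - 1)) := by
    ext t
    unfold cutFract
    by_cases h : t ∈ Ioi (1 : ℝ)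
    · rw [indicator_of_mem h, indicator_of_mem h, smul_eq_mul, mul_comm]
    · rw [indicator_of_notMem h, indicator_of_notMem h, smul_zero]
  rw [mellin, h1, MeasureTheory.setIntegral_indicator measurableSet_Ioi]
  congr 2
  rw [inter_eq_right]
  exact Ioi_subset_Ioi zero_le_one

lemma norm_mellin_cutFract_le {s : ℂ} (hs : s.re < 0) : ‖mellin cutFract s‖ ≤ 1 / (-s.re) := by
  rw [mellin_cutFract]
  have hI : ∫ t in Ioi (1 : ℝ), t ^ (s.re - 1) = 1 / (-s.re) := by
    rw [integral_Ioi_rpow_of_lt (by linarith) one_pos]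
    simp [neg_div]
  rw [← hI]
  refine MeasureTheory.norm_integral_le_of_norm_le
    (integrableOn_Ioi_rpow_of_lt (by linarith) one_pos) ?_
  refine MeasureTheory.ae_restrict_of_forall_mem measurableSet_Ioi fun t ht => ?_
  have ht0 : 0 < t := lt_trans one_pos ht
  rw [norm_mul, norm_cpow_eq_rpow_re_of_pos ht0, norm_real, Real.norm_eq_abs,
    abs_of_nonneg (Int.fract_nonneg t)]
  refine (mul_le_of_le_one_left (by positivity) (Int.fract_lt_one t).le).trans (le_of_eq ?_)
  simp

lemma shiftedZeta_eq_of_re_pos {s : ℂ} (hs : 0 < s.re) :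
    shiftedZeta s = (1 + s) - (1 + s) * s * mellin cutFract (-(1 + s)) := by
  have hs0 : s ≠ 0 := by rintro rfl; simp at hs
  have h1s : (1 : ℂ) + s ≠ 0 := by
    intro h; have := congrArg re h; simp at this; linarith
  have hw : 1 < (1 + s).re := by simpa using hs
  have hz : riemannZeta (1 + s) =
      (1 + s) * ∫ t in Ioi (1 : ℝ), ((⌊t⌋₊ : ℝ) : ℂ) * (t : ℂ) ^ (-((1 + s) + 1)) := by
    rw [← LSeries_one_eq_riemannZeta hw, LSeries_eq_mul_integral' (1 : ℕ → ℂ) zero_le_one hw]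
    · simp
    · refine Asymptotics.IsBigO.of_bound 1 (Filter.Eventually.of_forall fun n => ?_)
      simp
  have hi1 : MeasureTheory.IntegrableOn (fun t : ℝ => (t : ℂ) ^ (-(1 + s))) (Ioi 1) :=
    integrableOn_Ioi_cpow_of_lt (by simp; linarith) one_pos
  have hi2 : MeasureTheory.IntegrableOn
      (fun t : ℝ => ((Int.fract t : ℝ) : ℂ) * (t : ℂ) ^ (-(1 + s) - 1)) (Ioi 1) := by
    have := integrableOn_Ioi_cpow_of_lt (a := -(1 + s) - 1) (by simp; linarith) one_pos
    refine MeasureTheory.Integrable.bdd_mul this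
      (measurable_ofReal.comp measurable_fract).aestronglyMeasurable (c := 1)
      (Filter.Eventually.of_forall fun t => ?_)
    rw [norm_real, Real.norm_eq_abs, abs_of_nonneg (Int.fract_nonneg t)]
    exact (Int.fract_lt_one t).le
  have hintegral : ∫ t in Ioi (1 : ℝ), ((⌊t⌋₊ : ℝ) : ℂ) * (t : ℂ) ^ (-((1 + s) + 1))
      = 1 / s - mellin cutFract (-(1 + s)) := by
    have e1 : ∫ t in Ioi (1 : ℝ), (t : ℂ) ^ (-(1 + s)) = 1 / s := by
      rw [integral_Ioi_cpow_of_lt (by simp; linarith) one_pos]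
      rw [ofReal_one, one_cpow, show -(1 + s) + 1 = -s by ring]
      field_simp
    rw [mellin_cutFract, ← e1, ← MeasureTheory.integral_sub hi1 hi2]
    refine MeasureTheory.setIntegral_congr_fun measurableSet_Ioi fun t ht => ?_
    have ht0 : 0 < t := lt_trans one_pos ht
    have htc : (t : ℂ) ≠ 0 := by exact_mod_cast ht0.ne'
    have e2 : (t : ℂ) ^ (-(1 + s)) = t * (t : ℂ) ^ (-(1 + s) - 1) := by
      rw [cpow_sub _ _ htc, cpow_one]; field_simp
    have e3 : (⌊t⌋₊ : ℝ) = t - Int.fract t := by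
      rw [natCast_floor_eq_intCast_floor ht0.le]
      linarith [Int.floor_add_fract t]
    rw [e2, e3, show -((1 + s) + 1) = -(1 + s) - 1 by ring]
    push_cast
    ring
  rw [shiftedZeta_apply hs0, hz, hintegral]
  field_simp

lemma shiftedZeta_eq {s : ℂ} (hs : -1 < s.re) :
    shiftedZeta s = (1 + s) - (1 + s) * s * mellin cutFract (-(1 + s)) := by
  have hopen : IsOpen {s : ℂ | -1 < s.re} := isOpen_lt continuous_const continuous_re
  have hpre : IsPreconnected {s : ℂ | -1 < s.re} := (convex_halfSpace_re_gt (-1)).isPreconnected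
  have hd : DifferentiableOn ℂ (fun s => (1 + s) - (1 + s) * s * mellin cutFract (-(1 + s)))
      {s : ℂ | -1 < s.re} := by
    intro s hs
    have hs' : -1 < s.re := hs
    have h : DifferentiableAt ℂ (mellin cutFract ∘ fun s => -(1 + s)) s :=
      DifferentiableAt.comp (g := mellin cutFract) (f := fun s => -(1 + s)) s
        (differentiableAt_mellin_cutFract (by simp; linarith)) (by fun_prop)
    have h2 : DifferentiableAt ℂ (fun s : ℂ => 1 + s) s := by fun_prop
    exact (h2.sub ((h2.mul differentiableAt_id).mul h)).differentiableWithinAt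
  refine (differentiable_shiftedZeta.differentiableOn.analyticOnNhd hopen).eqOn_of_preconnected_of_eventuallyEq
    (hd.analyticOnNhd hopen) hpre (z₀ := 1) (by simp) ?_ hs
  have : {s : ℂ | 0 < s.re} ∈ nhds (1 : ℂ) :=
    (isOpen_lt continuous_const continuous_re).mem_nhds (by simp)
  filter_upwards [this] with s hs using shiftedZeta_eq_of_re_pos hs

lemma norm_shiftedZeta_le {s : ℂ} (hs : -(3 / 4) ≤ s.re) :
    ‖shiftedZeta s‖ ≤ 4 * (1 + ‖s‖) ^ 2 := by
  rw [shiftedZeta_eq (by linarith)]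
  have h1 : ‖mellin cutFract (-(1 + s))‖ ≤ 4 := by
    refine (norm_mellin_cutFract_le (by simp; linarith)).trans ?_
    rw [div_le_iff₀ (by simp; linarith)]
    simp; linarith
  have h2 : ‖1 + s‖ ≤ 1 + ‖s‖ := by simpa using norm_add_le 1 s
  calc ‖(1 + s) - (1 + s) * s * mellin cutFract (-(1 + s))‖
      ≤ ‖1 + s‖ + ‖1 + s‖ * ‖s‖ * ‖mellin cutFract (-(1 + s))‖ := by
        refine (norm_sub_le _ _).trans ?_
        rw [norm_mul, norm_mul]
    _ ≤ (1 + ‖s‖) + (1 + ‖s‖) * ‖s‖ * 4 := by gcongr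
    _ ≤ 4 * (1 + ‖s‖) ^ 2 := by nlinarith [norm_nonneg s]

lemma norm_riemannZeta_one_add_ofReal_le {σ : ℝ} (hσ : 0 < σ) :
    ‖riemannZeta (1 + σ)‖ ≤ 2 + 1 / σ := by
  have hre : 0 < (σ : ℂ).re := by simpa using hσ
  have hσ0 : (σ : ℂ) ≠ 0 := by exact_mod_cast hσ.ne'
  have h := shiftedZeta_eq_of_re_pos hre
  rw [shiftedZeta_apply hσ0] at h
  have h1 : ‖mellin cutFract (-(1 + σ))‖ ≤ 1 / (1 + σ) := by
    refine (norm_mellin_cutFract_le (by simp; linarith)).trans (le_of_eq ?_)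
    simp
  have h2 : ‖(1 : ℂ) + σ‖ = 1 + σ := by
    rw [show (1 : ℂ) + σ = ((1 + σ : ℝ) : ℂ) by push_cast; rfl, norm_real, Real.norm_eq_abs,
      abs_of_pos (by linarith)]
  have h3 : σ * ‖riemannZeta (1 + σ)‖ ≤ (1 + σ) + (1 + σ) * σ * (1 / (1 + σ)) := by
    have : σ * ‖riemannZeta (1 + σ)‖ = ‖(σ : ℂ) * riemannZeta (1 + σ)‖ := by
      rw [norm_mul, norm_real, Real.norm_eq_abs, abs_of_pos hσ]
    rw [this, h]
    refine (norm_sub_le _ _).trans ?_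
    rw [norm_mul, norm_mul, h2, norm_real, Real.norm_eq_abs, abs_of_pos hσ]
    gcongr
  have h4 : (1 + σ) + (1 + σ) * σ * (1 / (1 + σ)) = σ * (2 + 1 / σ) := by field_simp; ring
  rw [h4] at h3
  exact le_of_mul_le_mul_left h3 hσ

/-- An `L`-series with coefficients bounded by `1` is bounded by the zeta function. -/
lemma norm_LSeries_le {f : ℕ → ℂ} (hf : ∀ n, n ≠ 0 → ‖f n‖ ≤ 1) {s : ℂ} (hs : 0 < s.re) :
    ‖LSeries f (1 + s)‖ ≤ 2 + 1 / s.re := by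
  have hs1 : 1 < ((1 : ℂ) + (s.re : ℂ)).re := by simpa using hs
  have hsum : Summable (fun n => ‖LSeries.term 1 (1 + (s.re : ℂ)) n‖) :=
    (LSeriesSummable_one_iff.mpr hs1).norm
  have hle : ∀ n, ‖LSeries.term f (1 + s) n‖ ≤ ‖LSeries.term 1 (1 + (s.re : ℂ)) n‖ := by
    intro n
    rw [LSeries.norm_term_eq, LSeries.norm_term_eq]
    split_ifs with h
    · rfl
    · simp only [add_re, one_re, ofReal_re, Pi.one_apply, norm_one]
      gcongr
      exact hf n h
  have h1 : ‖LSeries f (1 + s)‖ ≤ ∑' n, ‖LSeries.term 1 (1 + (s.re : ℂ)) n‖ :=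
    tsum_of_norm_bounded hsum.hasSum hle
  have h2 : (∑' n, ‖LSeries.term 1 (1 + (s.re : ℂ)) n‖ : ℝ) = ‖riemannZeta (1 + s.re)‖ := by
    rw [← LSeries_one_eq_riemannZeta hs1, LSeries]
    have h3 : ∀ n, LSeries.term 1 (1 + (s.re : ℂ)) n
        = ((‖LSeries.term 1 (1 + (s.re : ℂ)) n‖ : ℝ) : ℂ) := by
      intro n
      rw [LSeries.norm_term_eq, LSeries.term_def]
      split_ifs with h
      · simp
      · simp only [Pi.one_apply, add_re, one_re, ofReal_re, norm_one]
        rw [ofReal_div, ofReal_cpow (by positivity)]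
        push_cast
        rfl
    rw [tsum_congr h3, ← ofReal_tsum, norm_real, Real.norm_eq_abs,
      abs_of_nonneg (tsum_nonneg fun n => norm_nonneg _)]
  rw [h2] at h1
  exact h1.trans (norm_riemannZeta_one_add_ofReal_le hs)

lemma norm_inv_riemannZeta_le {s : ℂ} (hs : 0 < s.re) :
    ‖(riemannZeta (1 + s))⁻¹‖ ≤ 2 + 1 / s.re := by
  have hs1 : 1 < (1 + s).re := by simpa using hs
  have h := LSeries_one_mul_Lseries_moebius hs1
  rw [LSeries_one_eq_riemannZeta hs1] at h
  rw [← eq_inv_of_mul_eq_one_right h]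
  refine norm_LSeries_le (fun n _ => ?_) hs
  rw [norm_intCast]
  exact_mod_cast ArithmeticFunction.abs_moebius_le_one

lemma norm_inv_shiftedZeta_le {s : ℂ} (hs : 0 < s.re) :
    ‖(shiftedZeta s)⁻¹‖ ≤ (2 + 1 / s.re) / ‖s‖ := by
  have hs0 : s ≠ 0 := by rintro rfl; simp at hs
  rw [shiftedZeta_apply hs0, mul_inv, norm_mul, norm_inv s, mul_comm, ← div_eq_mul_inv]
  gcongr
  exact norm_inv_riemannZeta_le hs

end

section

open Complex Set

lemma norm_shiftedZeta_add_le {s z : ℂ} (h0 : 0 < s.re) (h1 : s.re ≤ 1) (hz : ‖z‖ ≤ 1 / 2) :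
    ‖shiftedZeta (s + z)‖ ≤ (12 * (|s.im| + 3) ^ 2 / s.re ^ 2) * ‖shiftedZeta s‖ := by
  have hne : shiftedZeta s ≠ 0 := shiftedZeta_ne_zero h0.le
  have hpos : 0 < ‖shiftedZeta s‖ := norm_pos_iff.mpr hne
  have hs : ‖s‖ ≤ 1 + |s.im| := by
    have := norm_le_abs_re_add_abs_im s
    rw [abs_of_pos h0] at this
    linarith
  have hres : s.re ≤ ‖s‖ := (le_abs_self _).trans (abs_re_le_norm s)
  have hs0 : 0 < ‖s‖ := h0.trans_le hres
  have hzre := (abs_le.mp ((abs_re_le_norm z).trans hz)).1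
  have e1 : ‖shiftedZeta (s + z)‖ ≤ 4 * (|s.im| + 3) ^ 2 := by
    refine (norm_shiftedZeta_le (by simp; linarith)).trans ?_
    have : 1 + ‖s + z‖ ≤ |s.im| + 3 := by linarith [norm_add_le s z]
    gcongr
  have e2 : 1 ≤ 3 / s.re ^ 2 * ‖shiftedZeta s‖ := by
    have h := norm_inv_shiftedZeta_le h0
    rw [norm_inv, inv_le_comm₀ hpos (by positivity)] at h
    have h3 : s.re ^ 2 / 3 ≤ ((2 + 1 / s.re) / ‖s‖)⁻¹ := by
      rw [inv_div, div_le_div_iff₀ (by norm_num) (by positivity)]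
      have : s.re ^ 2 * (2 + 1 / s.re) ≤ s.re * 3 := by
        have : s.re ^ 2 * (2 + 1 / s.re) = s.re * (2 * s.re + 1) := by field_simp
        rw [this]; gcongr; linarith
      linarith
    have := h3.trans h
    rw [div_mul_eq_mul_div, le_div_iff₀ (by positivity)]
    linarith
  calc ‖shiftedZeta (s + z)‖ ≤ 4 * (|s.im| + 3) ^ 2 * 1 := by simpa using e1
    _ ≤ 4 * (|s.im| + 3) ^ 2 * (3 / s.re ^ 2 * ‖shiftedZeta s‖) := by gcongr
    _ = _ := by ring

lemma one_le_log_abs_add_three (t : ℝ) : 1 ≤ Real.log (|t| + 3) := by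
  rw [Real.le_log_iff_exp_le (by positivity)]
  linarith [Real.exp_one_lt_d9, abs_nonneg t]

lemma deriv_comp_const_add_zero (f : ℂ → ℂ) (s : ℂ) :
    deriv (fun z => f (s + z)) 0 = deriv f s := by
  rw [deriv_comp_const_add]; simp

lemma neg_re_logDeriv_shiftedZeta_le {s : ℂ} (h0 : 0 < s.re) (h1 : s.re ≤ 1) :
    -(deriv shiftedZeta s / shiftedZeta s).re
      ≤ 16 * (Real.log (12 * (|s.im| + 3) ^ 2 / s.re ^ 2) + 1) := by
  set Q := 12 * (|s.im| + 3) ^ 2 / s.re ^ 2 with hQ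
  have hQ1 : 1 ≤ Q := by
    rw [hQ, le_div_iff₀ (by positivity)]
    nlinarith [abs_nonneg s.im]
  have hM : 0 ≤ Real.log Q := Real.log_nonneg hQ1
  obtain ⟨n, hn⟩ := exists_nat_gt (Real.log Q / Real.log 2)
  have hl2 : 0 < Real.log 2 := Real.log_pos (by norm_num)
  have := neg_re_logDeriv_le (R := 1 / 2) (by norm_num) n (fun z => shiftedZeta (s + z)) (Real.log Q)
    (differentiable_shiftedZeta.comp (by fun_prop)) (by simpa using shiftedZeta_ne_zero h0.le) hM
    ((div_lt_iff₀ hl2).mp hn) ?_ ?_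
  · rw [deriv_comp_const_add_zero, add_zero] at this
    linarith
  · intro z hz
    rw [Real.exp_log (by linarith), add_zero]
    exact norm_shiftedZeta_add_le h0 h1 (by simpa using hz)
  · intro z hz h
    by_contra hc
    push Not at hc
    exact shiftedZeta_ne_zero (s := s + z) (by simp; linarith) h

lemma neg_re_logDeriv_shiftedZeta_le_sub {s : ℂ} (h0 : 0 < s.re) (h1 : s.re ≤ 1) {x : ℝ}
    (hx : 0 < x) (hx4 : x ≤ 1 / 4) (hz : shiftedZeta (s - x) = 0) :
    -(deriv shiftedZeta s / shiftedZeta s).re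
      ≤ 16 * (Real.log (12 * (|s.im| + 3) ^ 2 / s.re ^ 2) + 1) - 1 / x + 4 * x := by
  set Q := 12 * (|s.im| + 3) ^ 2 / s.re ^ 2 with hQ
  have hQ1 : 1 ≤ Q := by
    rw [hQ, le_div_iff₀ (by positivity)]
    nlinarith [abs_nonneg s.im]
  have hM : 0 ≤ Real.log Q := Real.log_nonneg hQ1
  have := neg_re_logDeriv_le_sub (R := 1 / 2) (M := Real.log Q) (x := x) (by norm_num)
    (f := fun z => shiftedZeta (s + z))
    (differentiable_shiftedZeta.comp (by fun_prop)) (by simpa using shiftedZeta_ne_zero h0.le) hM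
    ?_ ?_ hx (by linarith) (by simpa [sub_eq_add_neg] using hz)
  · rw [deriv_comp_const_add_zero, add_zero] at this
    have e : x / (1 / 2) ^ 2 = 4 * x := by ring
    linarith
  · intro z hz
    rw [Real.exp_log (by linarith), add_zero]
    exact norm_shiftedZeta_add_le h0 h1 (by simpa using hz)
  · intro z hz h
    by_contra hc
    push Not at hc
    exact shiftedZeta_ne_zero (s := s + z) (by simp; linarith) h

lemma LSeries_vonMangoldt_one_add {s : ℂ} (hs : 0 < s.re) :
    LSeries (fun n => (ArithmeticFunction.vonMangoldt n : ℂ)) (1 + s)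
      = 1 / s - deriv shiftedZeta s / shiftedZeta s := by
  have hs0 : s ≠ 0 := by rintro rfl; simp at hs
  have h1 : 1 < (1 + s).re := by simpa using hs
  have hζ : riemannZeta (1 + s) ≠ 0 := riemannZeta_ne_zero_of_one_le_re h1.le
  have hd : HasDerivAt (fun z => riemannZeta (1 + z)) (deriv riemannZeta (1 + s)) s := by
    have : DifferentiableAt ℂ riemannZeta (1 + s) := differentiableAt_riemannZeta (by simpa using hs0)
    exact this.hasDerivAt.comp_const_add 1 s
  have hderiv : deriv shiftedZeta s = riemannZeta (1 + s) + s * deriv riemannZeta (1 + s) := by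
    rw [(shiftedZeta_eventuallyEq hs0).deriv_eq]
    simpa using ((hasDerivAt_id' s).fun_mul hd).deriv
  rw [ArithmeticFunction.LSeries_vonMangoldt_eq_deriv_riemannZeta_div h1, hderiv,
    shiftedZeta_apply hs0]
  field_simp
  ring

lemma re_LSeries_vonMangoldt_comb_nonneg {σ : ℝ} (hσ : 0 < σ) (t : ℝ) :
    0 ≤ 3 * (LSeries (fun n => (ArithmeticFunction.vonMangoldt n : ℂ)) (1 + σ)).re
      + 4 * (LSeries (fun n => (ArithmeticFunction.vonMangoldt n : ℂ)) (1 + (σ + t * I))).re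
      + (LSeries (fun n => (ArithmeticFunction.vonMangoldt n : ℂ)) (1 + (σ + 2 * t * I))).re := by
  have hsum : ∀ u : ℝ, HasSum (fun n => ArithmeticFunction.vonMangoldt n * (n : ℝ) ^ (-(1 + σ))
      * Real.cos (u * Real.log n))
      (LSeries (fun n => (ArithmeticFunction.vonMangoldt n : ℂ)) (1 + (σ + u * I))).re := by
    intro u
    have h := (ArithmeticFunction.LSeriesSummable_vonMangoldt
      (s := 1 + (σ + u * I)) (by simpa using hσ)).hasSum.mapL reCLM
    convert h using 2 with n
    rw [LSeries.term_def]
    split_ifs with hn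
    · simp [hn]
    · have hn' : (0 : ℝ) < n := by positivity
      have e : ((n : ℂ) ^ (1 + (σ + u * I)))⁻¹ = cexp (((-(1 + σ) * Real.log n : ℝ) : ℂ)
          + ((-(u * Real.log n) : ℝ) : ℂ) * I) := by
        rw [← cpow_neg, cpow_def_of_ne_zero (by exact_mod_cast hn), natCast_log.symm]
        congr 1
        push_cast
        ring
      rw [div_eq_mul_inv, e, reCLM_apply, re_ofReal_mul, exp_re]
      simp only [add_re, ofReal_re, re_ofReal_mul, I_re, mul_zero, add_zero, add_im, ofReal_im,
        im_ofReal_mul, I_im, mul_one, zero_add, Real.cos_neg]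
      rw [Real.rpow_def_of_pos hn', mul_comm (Real.log n), mul_assoc]
    · rfl
  have h0 := hsum 0
  have h1 := hsum t
  have h2 := hsum (2 * t)
  have h := ((h0.mul_left 3).add (h1.mul_left 4)).add h2
  have := h.nonneg fun n => ?_
  · simpa using this
  · have hc : 0 ≤ 3 + 4 * Real.cos (t * Real.log n) + Real.cos (2 * t * Real.log n) := by
      rw [mul_assoc 2, Real.cos_two_mul]
      nlinarith [sq_nonneg (Real.cos (t * Real.log n) + 1)]
    have hp : 0 ≤ ArithmeticFunction.vonMangoldt n * (n : ℝ) ^ (-(1 + σ)) :=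
      mul_nonneg ArithmeticFunction.vonMangoldt_nonneg (by positivity)
    have := mul_nonneg hp hc
    simp only [zero_mul, Real.cos_zero, mul_one]
    linarith

lemma log_quotient_le {t u σ : ℝ} (hσ : σ = 1 / (32768 * Real.log (|t| + 3)))
    (hu : |u| ≤ 2 * |t|) :
    Real.log (12 * (|u| + 3) ^ 2 / σ ^ 2) ≤ 27 * Real.log (|t| + 3) := by
  have hL := one_le_log_abs_add_three t
  set E := |t| + 3 with hE
  have hE3 : 3 ≤ E := by linarith [abs_nonneg t]
  have hLE : Real.log E ≤ E := by linarith [Real.log_le_sub_one_of_pos (show 0 < E by linarith)]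
  have hσ0 : 0 < σ := by rw [hσ]; positivity
  rw [show 27 * Real.log E = Real.log (E ^ 27) by rw [Real.log_pow]; norm_num]
  apply Real.log_le_log (by positivity)
  have h1 : |u| + 3 ≤ 2 * E := by linarith
  calc 12 * (|u| + 3) ^ 2 / σ ^ 2 = 12 * (|u| + 3) ^ 2 * (32768 * Real.log E) ^ 2 := by
        rw [hσ]; field_simp
    _ ≤ 12 * (2 * E) ^ 2 * (32768 * E) ^ 2 := by gcongr
    _ = (48 * 32768 ^ 2) * E ^ 4 := by ring
    _ ≤ 3 ^ 23 * E ^ 4 := by gcongr; norm_num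
    _ ≤ E ^ 23 * E ^ 4 := by gcongr
    _ = E ^ 27 := by ring

lemma shiftedZeta_ne_zero_of_one_le_abs_im {s : ℂ} (ht : 1 ≤ |s.im|)
    (hs : -(1 / 200000) / Real.log (|s.im| + 3) ≤ s.re) : shiftedZeta s ≠ 0 := by
  intro h0
  rcases le_or_gt 0 s.re with hre | hre
  · exact shiftedZeta_ne_zero hre h0
  have hL := one_le_log_abs_add_three s.im
  set t := s.im with ht'
  set L := Real.log (|t| + 3) with hLdef
  obtain ⟨σ, hσ⟩ : ∃ σ, σ = 1 / (32768 * L) := ⟨_, rfl⟩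
  have hσ0 : 0 < σ := by rw [hσ]; positivity
  have hσL : σ * L = 1 / 32768 := by rw [hσ]; field_simp
  have hσ1 : σ ≤ 1 / 32768 := by nlinarith
  set x := σ - s.re with hx
  have hx0 : 0 < x := by linarith
  have hbL : -s.re * L ≤ 1 / 200000 := by
    rw [div_le_iff₀ (by linarith)] at hs
    linarith
  have hb : -s.re ≤ 1 / 200000 := by nlinarith
  have hx4 : x ≤ 1 / 4 := by rw [hx]; linarith
  have d1 := neg_re_logDeriv_shiftedZeta_le (s := (σ : ℂ)) (by simpa using hσ0)
    (by simp; linarith)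
  have d2 := neg_re_logDeriv_shiftedZeta_le_sub (s := (σ : ℂ) + t * I) (x := x)
    (by simpa using hσ0) (by simp; linarith) hx0 hx4 (by
      rw [← h0]; congr 1
      apply Complex.ext <;> simp [hx, ht'])
  have d3 := neg_re_logDeriv_shiftedZeta_le (s := (σ : ℂ) + 2 * t * I)
    (by simpa using hσ0) (by simp; linarith)
  have q1 := log_quotient_le (t := t) (u := 0) hσ (by simp)
  have q2 := log_quotient_le (t := t) (u := t) hσ (by linarith [abs_nonneg t])
  have q3 := log_quotient_le (t := t) (u := 2 * t) hσ (by simp [abs_mul])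
  have r1 : ((1 : ℂ) / σ).re = 1 / σ := by
    rw [show (1 : ℂ) / σ = ((1 / σ : ℝ) : ℂ) by push_cast; rfl, ofReal_re]
  have hr : ∀ u : ℝ, 1 ≤ |u| → ((1 : ℂ) / (σ + u * I)).re ≤ 1 := by
    intro u hu
    refine (re_le_norm _).trans ?_
    rw [norm_div, norm_one, div_le_one (by
      rw [norm_pos_iff]; intro h; have := congrArg re h; simp at this; linarith)]
    have := abs_im_le_norm ((σ : ℂ) + u * I)
    simp at this
    linarith
  have r2 := hr t ht
  have r3 := hr (2 * t) (by rw [abs_mul, abs_two]; linarith)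
  have key := re_LSeries_vonMangoldt_comb_nonneg hσ0 t
  rw [LSeries_vonMangoldt_one_add (by simpa using hσ0),
    LSeries_vonMangoldt_one_add (by simpa using hσ0),
    LSeries_vonMangoldt_one_add (by simpa using hσ0)] at key
  simp only [sub_re, r1] at key
  push_cast at r3
  have i1 : ((σ : ℂ)).im = 0 := ofReal_im _
  have i2 : ((σ : ℂ) + t * I).im = t := by simp
  have i3 : ((σ : ℂ) + 2 * t * I).im = 2 * t := by simp
  have j1 : ((σ : ℂ)).re = σ := ofReal_re _
  have j2 : ((σ : ℂ) + t * I).re = σ := by simp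
  have j3 : ((σ : ℂ) + 2 * t * I).re = σ := by simp
  rw [i1, j1] at d1
  rw [i2, j2] at d2
  rw [i3, j3] at d3
  have hfin : 4 / x ≤ 3 / σ + 3605 * L := by
    have e1 : 3 / σ = 3 * (1 / σ) := by ring
    have e2 : 4 / x = 4 * (1 / x) := by ring
    linarith
  have e3 : 3 / σ = 98304 * L := by rw [hσ]; field_simp; norm_num
  rw [e3, div_le_iff₀ hx0] at hfin
  have : x * L ≤ 1 / 32768 + 1 / 200000 := by
    rw [hx, sub_mul]; linarith
  nlinarith

/-- The classical zero-free region. -/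
lemma exists_zeroFree_region : ∃ η : ℝ, 0 < η ∧ η ≤ 1 ∧
    ∀ s : ℂ, -η / Real.log (|s.im| + 3) ≤ s.re → shiftedZeta s ≠ 0 := by
  have hK : IsCompact (Icc (0 : ℝ) 1 ×ℂ Icc (-1 : ℝ) 1) := isCompact_Icc.reProdIm isCompact_Icc
  obtain ⟨δ, hδ, hsub⟩ := hK.exists_thickening_subset_open
    (differentiable_shiftedZeta.continuous.isOpen_preimage _ isOpen_ne)
    (fun s (hs : s ∈ Icc (0 : ℝ) 1 ×ℂ Icc (-1 : ℝ) 1) => shiftedZeta_ne_zero hs.1.1)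
  refine ⟨min (δ / 2) (1 / 200000), by positivity, (min_le_right _ _).trans (by norm_num), ?_⟩
  intro s hs
  have hL := one_le_log_abs_add_three s.im
  rcases le_or_gt 1 |s.im| with h | h
  · refine shiftedZeta_ne_zero_of_one_le_abs_im h (le_trans ?_ hs)
    gcongr
    exact min_le_right _ _
  · rcases le_or_gt 0 s.re with hre | hre
    · exact shiftedZeta_ne_zero hre
    · have hre2 : -(δ / 2) ≤ s.re := by
        refine le_trans ?_ hs
        rw [le_div_iff₀ (by linarith)]
        have := min_le_left (δ / 2) (1 / 200000)
        nlinarith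
      refine hsub (Metric.mem_thickening_iff.mpr ⟨s.im * I, ⟨by simp, by simpa using abs_le.mp h.le⟩, ?_⟩)
      have : s - s.im * I = (s.re : ℂ) := by apply Complex.ext <;> simp
      rw [dist_eq, this, norm_real, Real.norm_eq_abs, abs_of_neg hre]
      linarith

end

section

open Complex Set

lemma log_le_two_mul_sqrt {E : ℝ} (hE : 0 < E) : Real.log E ≤ 2 * √E := by
  have h : Real.log (√E) = Real.log E / 2 := Real.log_sqrt hE.le
  have := Real.log_le_sub_one_of_pos (Real.sqrt_pos.mpr hE)
  linarith

lemma norm_inv_shiftedZeta_le_of_one_le_abs_im {κ : ℝ} (hκ : 0 < κ) (hκ1 : κ ≤ 1) {s : ℂ}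
    (ht : 1 ≤ |s.im|) (hs : κ / Real.log (|s.im| + 3) ≤ s.re) :
    ‖(shiftedZeta s)⁻¹‖ ≤ 12 / κ * (Real.log (|s.im| + 3) / (|s.im| + 3)) := by
  have hL := one_le_log_abs_add_three s.im
  set L := Real.log (|s.im| + 3)
  have hk : 0 < κ / L := by positivity
  have hre : 0 < s.re := hk.trans_le hs
  have h1 : 1 / s.re ≤ L / κ := by
    rw [← one_div_div κ L]
    exact one_div_le_one_div_of_le hk hs
  have h2 : 1 ≤ L / κ := by rw [le_div_iff₀ hκ]; linarith
  calc ‖(shiftedZeta s)⁻¹‖ ≤ (2 + 1 / s.re) / ‖s‖ := norm_inv_shiftedZeta_le hre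
    _ ≤ (3 * (L / κ)) / ((|s.im| + 3) / 4) := by
        gcongr
        · linarith
        · linarith [abs_im_le_norm s]
    _ = _ := by field_simp; norm_num

lemma norm_inv_shiftedZeta_le_left {η : ℝ} (hη : 0 < η) (hη1 : η ≤ 1)
    (hz : ∀ s : ℂ, -η / Real.log (|s.im| + 3) ≤ s.re → shiftedZeta s ≠ 0) {s : ℂ}
    (ht : 1 ≤ |s.im|) (hs : -(η / 80) / Real.log (|s.im| + 3) ≤ s.re)
    (hs' : s.re ≤ (η / 80) / Real.log (|s.im| + 3)) :
    ‖(shiftedZeta s)⁻¹‖ ≤ 24 / (η / 80) * (12 / (η / 80) ^ 2) := by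
  have hL := one_le_log_abs_add_three s.im
  obtain ⟨κ, hκ⟩ : ∃ κ, κ = η / 80 := ⟨_, rfl⟩
  have hκ0 : 0 < κ := by rw [hκ]; positivity
  have hκ1 : κ ≤ 1 := by rw [hκ]; linarith
  rw [← hκ] at hs hs' ⊢
  set E := |s.im| + 3 with hE
  have hE3 : 3 ≤ E := by linarith [abs_nonneg s.im]
  set L := Real.log E with hLdef
  have hLE : L ≤ E := by linarith [Real.log_le_sub_one_of_pos (show 0 < E by linarith)]
  set k := κ / L with hk
  have hk0 : 0 < k := by positivity
  have hk1 : k ≤ 1 := by rw [hk, div_le_one (by linarith)]; linarith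
  have hr80 : η / (2 * L) = 40 * k := by rw [hk, hκ]; field_simp; norm_num
  set s₀ : ℂ := k + s.im * I with hs₀
  have hre₀ : s₀.re = k := by simp [hs₀]
  have him₀ : s₀.im = s.im := by simp [hs₀]
  set Q := 12 * (|s₀.im| + 3) ^ 2 / s₀.re ^ 2 with hQ
  have hQE : Q ≤ 12 / κ ^ 2 * E ^ 4 := by
    rw [hQ, hre₀, him₀, ← hE, hk]
    calc 12 * E ^ 2 / (κ / L) ^ 2 = 12 / κ ^ 2 * (E ^ 2 * L ^ 2) := by field_simp
      _ ≤ 12 / κ ^ 2 * (E ^ 2 * E ^ 2) := by gcongr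
      _ = _ := by ring
  have hQ1 : 1 < Q := by
    rw [hQ, hre₀, him₀, lt_div_iff₀ (by positivity)]
    nlinarith
  have hM : 0 < Real.log Q := Real.log_pos hQ1
  have hA : 1 ≤ 12 / κ ^ 2 := by rw [le_div_iff₀ (by positivity)]; nlinarith
  have hr40 : 40 * k ≤ 1 / 2 := by
    rw [← hr80, div_le_div_iff₀ (by positivity) (by norm_num)]; nlinarith
  obtain ⟨g, -, hg, -, hgb⟩ := exists_log_norm_le (f := fun z => shiftedZeta (s₀ + z)) (r := 40 * k)
    (M := Real.log Q) (by positivity) hM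
    (differentiable_shiftedZeta.comp (by fun_prop)).differentiableOn (by
      intro z hzb
      rw [mem_ball_zero_iff] at hzb
      refine hz _ ?_
      have h1 := abs_le.mp ((abs_re_le_norm z).trans hzb.le)
      have h2 := (abs_im_le_norm z).trans hzb.le
      have h3 : |s.im + z.im| ≤ |s.im| + 1 := (abs_add_le _ _).trans (by linarith)
      have h4 : Real.log (|s.im + z.im| + 3) ≤ 2 * L := by
        rw [hLdef, show 2 * Real.log E = Real.log (E ^ 2) by rw [Real.log_pow]; norm_num]
        exact Real.log_le_log (by positivity) (by nlinarith)
      have h5 := one_le_log_abs_add_three (s.im + z.im)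
      rw [add_re, add_im, hre₀, him₀]
      have h6 : η / (2 * L) ≤ η / Real.log (|s.im + z.im| + 3) := by gcongr
      rw [neg_div]
      linarith) (by
      intro z hzb
      rw [mem_ball_zero_iff] at hzb
      rw [Real.exp_log (by linarith), add_zero]
      exact norm_shiftedZeta_add_le (by rw [hre₀]; exact hk0) (by rw [hre₀]; exact hk1)
        (by linarith))
  have hzk : ‖s - s₀‖ ≤ 2 * k := by
    have : s - s₀ = ((s.re - k : ℝ) : ℂ) := by apply Complex.ext <;> simp [hs₀]
    rw [this, norm_real, Real.norm_eq_abs, abs_le]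
    rw [neg_div, ← hk] at hs
    constructor <;> linarith
  have hmem : s - s₀ ∈ Metric.ball (0 : ℂ) (40 * k) := by
    rw [mem_ball_zero_iff]; linarith
  have h1 := hg _ hmem
  have h2 := hgb _ hmem
  simp only [add_sub_cancel, add_zero] at h1
  have h3 : ‖g (s - s₀)‖ ≤ Real.log Q / 8 := by
    refine h2.trans ?_
    rw [div_le_iff₀ (by linarith)]
    nlinarith
  have h4 : Real.exp (Real.log Q / 8) ≤ 12 / κ ^ 2 * √E := by
    rw [← Real.le_log_iff_exp_le (by positivity), Real.log_mul (by positivity) (by positivity),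
      Real.log_sqrt (by positivity)]
    have h5 := Real.log_le_log (by linarith) hQE
    rw [Real.log_mul (by positivity) (by positivity), Real.log_pow] at h5
    have := Real.log_nonneg hA
    push_cast at h5
    linarith
  have h0 := norm_inv_shiftedZeta_le_of_one_le_abs_im hκ0 hκ1 (s := s₀) (by rw [him₀]; exact ht)
    (by rw [him₀, hre₀])
  rw [him₀, ← hE, ← hLdef] at h0
  have h6 : ‖(cexp (g (s - s₀)))⁻¹‖ ≤ 12 / κ ^ 2 * √E := by
    rw [← exp_neg, norm_exp]
    refine le_trans (Real.exp_le_exp.mpr ?_) h4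
    have := (re_le_norm (-g (s - s₀)))
    rw [norm_neg] at this
    linarith
  have hL2 := log_le_two_mul_sqrt (show 0 < E by linarith)
  have hsq : √E * √E = E := Real.mul_self_sqrt (by linarith)
  rw [h1, mul_inv, norm_mul]
  calc ‖(shiftedZeta s₀)⁻¹‖ * ‖(cexp (g (s - s₀)))⁻¹‖
      ≤ (12 / κ * (L / E)) * (12 / κ ^ 2 * √E) := by gcongr
    _ ≤ (12 / κ * (2 * √E / E)) * (12 / κ ^ 2 * √E) := by gcongr
    _ = 24 / κ * (12 / κ ^ 2) * ((√E * √E) / E) := by ring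
    _ = 24 / κ * (12 / κ ^ 2) := by rw [hsq, div_self (by linarith), mul_one]

lemma exists_norm_inv_shiftedZeta_le : ∃ κ C : ℝ, 0 < κ ∧ κ ≤ 1 / 80 ∧ 0 < C ∧
    ∀ s : ℂ, -κ / Real.log (|s.im| + 3) ≤ s.re → s.re ≤ 1 →
      shiftedZeta s ≠ 0 ∧ ‖(shiftedZeta s)⁻¹‖ ≤ C := by
  obtain ⟨η, hη, hη1, hz⟩ := exists_zeroFree_region
  have hne : ∀ s : ℂ, -(η / 80) / Real.log (|s.im| + 3) ≤ s.re → shiftedZeta s ≠ 0 := by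
    intro s hs
    have hL := one_le_log_abs_add_three s.im
    refine hz s (le_trans ?_ hs)
    gcongr
    linarith
  set κ := η / 80 with hκ
  have hκ0 : 0 < κ := by positivity
  have hκ1 : κ ≤ 1 := by rw [hκ]; linarith
  have hK : IsCompact (Icc (-κ) 1 ×ℂ Icc (-1 : ℝ) 1) := isCompact_Icc.reProdIm isCompact_Icc
  have hcont : ContinuousOn (fun s => (shiftedZeta s)⁻¹) (Icc (-κ) 1 ×ℂ Icc (-1 : ℝ) 1) := by
    refine differentiable_shiftedZeta.continuous.continuousOn.inv₀ fun s hs => hz s ?_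
    refine le_trans ?_ hs.1.1
    have h1 : |s.im| ≤ 1 := abs_le.mpr hs.2
    have hL := one_le_log_abs_add_three s.im
    rw [div_le_iff₀ (by linarith)]
    have : Real.log (|s.im| + 3) ≤ 80 := by
      linarith [Real.log_le_sub_one_of_pos (show 0 < |s.im| + 3 by positivity)]
    rw [hκ]
    nlinarith
  obtain ⟨C₀, hC₀⟩ := hK.exists_bound_of_continuousOn hcont
  refine ⟨κ, max C₀ 0 + 12 / κ + 24 / κ * (12 / κ ^ 2), hκ0, by rw [hκ]; linarith, by positivity,
    fun s hs hs1 => ⟨hne s hs, ?_⟩⟩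
  have hL := one_le_log_abs_add_three s.im
  have p1 : 0 ≤ max C₀ 0 := le_max_right _ _
  have p2 : 0 < 12 / κ := by positivity
  have p3 : 0 < 24 / κ * (12 / κ ^ 2) := by positivity
  rcases lt_or_ge |s.im| 1 with ht | ht
  · have : ‖(shiftedZeta s)⁻¹‖ ≤ C₀ := hC₀ s ⟨⟨by
      refine le_trans ?_ hs
      rw [le_div_iff₀ (by linarith)]
      nlinarith, hs1⟩, abs_le.mp ht.le⟩
    linarith [le_max_left C₀ 0]
  · rcases le_total s.re (κ / Real.log (|s.im| + 3)) with h | h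
    · have := norm_inv_shiftedZeta_le_left hη hη1 hz ht hs h
      rw [← hκ] at this
      linarith
    · have h1 := norm_inv_shiftedZeta_le_of_one_le_abs_im hκ0 hκ1 ht h
      have h2 : Real.log (|s.im| + 3) / (|s.im| + 3) ≤ 1 := by
        rw [div_le_one (by positivity)]
        linarith [Real.log_le_sub_one_of_pos (show 0 < |s.im| + 3 by positivity)]
      have h3 := mul_le_mul_of_nonneg_left h2 p2.le
      linarith

end

section

open Complex Set MeasureTheory

lemma integrableOn_mul_exp_neg {σ : ℝ} (hσ : 0 < σ) :
    IntegrableOn (fun u : ℝ => u * Real.exp (-σ * u)) (Ioi 0) := by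
  simpa using integrableOn_rpow_mul_exp_neg_mul_rpow (p := 1) (s := 1) (b := σ)
    (by norm_num) one_pos hσ

lemma integral_mul_exp_neg {s : ℂ} (hs : 0 < s.re) :
    ∫ u : ℝ in Ioi 0, (u : ℂ) * cexp (-(s * u)) = 1 / s ^ 2 := by
  have hs0 : s ≠ 0 := by rintro rfl; simp at hs
  have hd : ∀ u ∈ Ici (0 : ℝ), HasDerivAt (fun u : ℝ => -((u : ℂ) / s + 1 / s ^ 2) * cexp (-(s * u)))
      ((u : ℂ) * cexp (-(s * u))) u := by
    intro u _
    have h1 : HasDerivAt (fun u : ℂ => -(u / s + 1 / s ^ 2) * cexp (-(s * u)))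
        ((u : ℂ) * cexp (-(s * u))) u := by
      have ha : HasDerivAt (fun u : ℂ => -(u / s + 1 / s ^ 2)) (-(1 / s)) u :=
        (((hasDerivAt_id' (u : ℂ)).div_const s).add_const _).neg
      have hb : HasDerivAt (fun u : ℂ => cexp (-(s * u))) (cexp (-(s * u)) * (-(s * 1))) u :=
        (((hasDerivAt_id' (u : ℂ)).const_mul s).neg).cexp
      have e : (u : ℂ) * cexp (-(s * u)) = -(1 / s) * cexp (-(s * u))
          + -(u / s + 1 / s ^ 2) * (cexp (-(s * u)) * (-(s * 1))) := by
        generalize cexp (-(s * u)) = w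
        field_simp
        ring
      rw [e]
      exact ha.fun_mul hb
    exact h1.comp_ofReal
  have hn : ∀ u : ℝ, ‖cexp (-(s * u))‖ = Real.exp (-s.re * u) := by
    intro u; rw [norm_exp]; simp
  have hintegral : IntegrableOn (fun u : ℝ => (u : ℂ) * cexp (-(s * u))) (Ioi 0) := by
    refine (integrableOn_mul_exp_neg hs).mono' (by fun_prop) ?_
    refine ae_restrict_of_forall_mem measurableSet_Ioi fun u hu => ?_
    rw [norm_mul, hn, norm_real, Real.norm_eq_abs, abs_of_pos hu]
  have hlim : Filter.Tendsto (fun u : ℝ => -((u : ℂ) / s + 1 / s ^ 2) * cexp (-(s * u)))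
      Filter.atTop (nhds 0) := by
    have t1 := tendsto_rpow_mul_exp_neg_mul_atTop_nhds_zero 1 s.re hs
    have t0 := tendsto_rpow_mul_exp_neg_mul_atTop_nhds_zero 0 s.re hs
    have t := (t1.mul_const (1 / ‖s‖)).add (t0.mul_const (1 / ‖s‖ ^ 2))
    simp only [zero_mul, add_zero, Real.rpow_one, Real.rpow_zero, one_mul] at t
    refine squeeze_zero_norm' ?_ t
    filter_upwards [Filter.eventually_ge_atTop 0] with u hu
    rw [norm_mul, hn, norm_neg]
    have : ‖(u : ℂ) / s + 1 / s ^ 2‖ ≤ u / ‖s‖ + 1 / ‖s‖ ^ 2 := by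
      refine (norm_add_le _ _).trans (le_of_eq ?_)
      rw [norm_div, norm_div, norm_pow, norm_one, norm_real, Real.norm_eq_abs, abs_of_nonneg hu]
    refine (mul_le_mul_of_nonneg_right this (Real.exp_pos _).le).trans (le_of_eq ?_)
    ring
  rw [integral_Ioi_of_hasDerivAt_of_tendsto' hd hintegral hlim]
  simp

lemma fourier_max_mul_exp {σ : ℝ} (hσ : 0 < σ) (ξ : ℝ) :
    FourierTransform.fourier (fun u : ℝ => ((max u 0 : ℝ) : ℂ) * cexp (-(σ * u))) ξ
      = 1 / (σ + (2 * Real.pi * ξ : ℝ) * I) ^ 2 := by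
  rw [Real.fourier_real_eq_integral_exp_smul, ← integral_mul_exp_neg (by simpa using hσ),
    ← integral_indicator measurableSet_Ioi]
  congr 1
  ext u
  by_cases hu : u ∈ Ioi (0 : ℝ)
  · rw [indicator_of_mem hu, max_eq_left (le_of_lt hu), smul_eq_mul, mul_left_comm, ← Complex.exp_add]
    congr 2
    push_cast
    ring
  · rw [indicator_of_notMem hu, max_eq_right (not_lt.mp hu)]
    simp

lemma integrable_one_div_sq {σ : ℝ} (hσ : 0 < σ) :
    Integrable fun t : ℝ => 1 / ((σ : ℂ) + t * I) ^ 2 := by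
  have hne : ∀ t : ℝ, (σ : ℂ) + t * I ≠ 0 := by
    intro t h
    have := congrArg re h
    simp at this
    linarith
  have hi : Integrable fun t : ℝ => (1 / σ ^ 2 + 1) * (1 + t ^ 2)⁻¹ :=
    integrable_inv_one_add_sq.const_mul _
  refine hi.mono' ?_ (Filter.Eventually.of_forall fun t => ?_)
  · refine Continuous.aestronglyMeasurable ?_
    exact continuous_const.div (by fun_prop) fun t => pow_ne_zero 2 (hne t)
  · have h : ‖(σ : ℂ) + t * I‖ ^ 2 = σ ^ 2 + t ^ 2 := by
      rw [← normSq_eq_norm_sq, normSq_apply]; simp; ring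
    rw [norm_div, norm_one, norm_pow, h, ← div_eq_mul_inv, div_le_div_iff₀ (by positivity)
      (by positivity)]
    have : (1 / σ ^ 2 + 1) * (σ ^ 2 + t ^ 2) = 1 + t ^ 2 / σ ^ 2 + σ ^ 2 + t ^ 2 := by
      field_simp; ring
    rw [this]
    nlinarith [sq_nonneg σ, div_nonneg (sq_nonneg t) (sq_nonneg σ)]

/-- The Perron formula for the ramp function. -/
lemma integral_exp_div_sq {σ : ℝ} (hσ : 0 < σ) (y : ℝ) :
    ∫ t : ℝ, cexp ((σ + t * I) * y) / (σ + t * I) ^ 2 = 2 * Real.pi * (max y 0 : ℝ) := by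
  set g : ℝ → ℂ := fun u : ℝ => ((max u 0 : ℝ) : ℂ) * cexp (-(σ * u)) with hg
  have hcont : Continuous g := by
    rw [hg]; fun_prop
  have hgi : Integrable g := by
    have h1 : Integrable (indicator (Ioi 0) fun u : ℝ => u * Real.exp (-σ * u)) :=
      (integrable_indicator_iff measurableSet_Ioi).mpr (integrableOn_mul_exp_neg hσ)
    refine h1.mono' hcont.aestronglyMeasurable (Filter.Eventually.of_forall fun u => ?_)
    rw [hg]
    by_cases hu : u ∈ Ioi (0 : ℝ)
    · rw [indicator_of_mem hu]
      have hu' : 0 < u := hu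
      simp only [max_eq_left hu'.le, norm_mul, norm_exp, norm_real, Real.norm_eq_abs,
        abs_of_pos hu']
      simp
    · rw [indicator_of_notMem hu]
      have hu' : u ≤ 0 := not_lt.mp hu
      simp [max_eq_right hu']
  have hF : FourierTransform.fourier g = fun ξ : ℝ => 1 / (σ + (2 * Real.pi * ξ : ℝ) * I) ^ 2 := by
    ext ξ; exact fourier_max_mul_exp hσ ξ
  have hpi : 2 * Real.pi ≠ 0 := by positivity
  have hFi : Integrable (FourierTransform.fourier g) := by
    rw [hF]
    exact (integrable_one_div_sq hσ).comp_mul_left' hpi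
  have hinv := hgi.fourierInv_fourier_eq hFi (v := y) hcont.continuousAt
  rw [Real.fourierInv_eq', hF] at hinv
  have hsub := Measure.integral_comp_mul_left
    (fun t : ℝ => cexp ((t * y : ℝ) * I) * (1 / (σ + t * I) ^ 2)) (2 * Real.pi)
  have e1 : (∫ v : ℝ, cexp (((2 * Real.pi * inner ℝ v y : ℝ) : ℂ) * I) •
      (1 / ((σ : ℂ) + (2 * Real.pi * v : ℝ) * I) ^ 2))
      = ∫ x : ℝ, cexp (((2 * Real.pi * x) * y : ℝ) * I) * (1 / (σ + (2 * Real.pi * x : ℝ) * I) ^ 2) := by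
    congr 1
    ext v
    simp only [smul_eq_mul, RCLike.inner_apply, conj_trivial]
    congr 3
    push_cast; ring
  rw [e1, hsub] at hinv
  have e2 : ∫ t : ℝ, cexp ((σ + t * I) * y) / (σ + t * I) ^ 2
      = cexp (σ * y) * ∫ t : ℝ, cexp ((t * y : ℝ) * I) * (1 / (σ + t * I) ^ 2) := by
    rw [← integral_const_mul]
    congr 1
    ext t
    rw [← mul_assoc, ← Complex.exp_add, mul_one_div]
    congr 2
    push_cast; ring
  rw [abs_of_pos (by positivity), inv_smul_eq_iff₀ hpi] at hinv
  rw [e2, hinv, hg, Complex.real_smul]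
  have : cexp (σ * y) * cexp (-(σ * y)) = 1 := by rw [← Complex.exp_add]; simp
  push_cast
  linear_combination (2 * Real.pi * (max (y : ℝ) 0 : ℝ) : ℂ) * this

end

section

open Complex Set MeasureTheory

lemma ofReal_add_mul_I_ne_zero {σ : ℝ} (hσ : 0 < σ) (t : ℝ) : (σ : ℂ) + t * I ≠ 0 := by
  intro h
  have := congrArg re h
  simp at this
  linarith

lemma continuous_LSeries_vertical {f : ℕ → ℂ} (hf : ∀ n, n ≠ 0 → ‖f n‖ ≤ 1) {σ : ℝ} (hσ : 0 < σ) :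
    Continuous fun t : ℝ => LSeries f (1 + (σ + t * I)) := by
  have ha : LSeries.abscissaOfAbsConv f ≤ 1 :=
    LSeries.abscissaOfAbsConv_le_of_le_const ⟨1, hf⟩
  have hd := (LSeries_differentiableOn f).continuousOn
  refine hd.comp_continuous (by fun_prop) fun t => ?_
  refine lt_of_le_of_lt ha ?_
  have : (1 : ℝ) < ((1 : ℂ) + (σ + t * I)).re := by simpa using hσ
  exact_mod_cast this

lemma norm_cexp_vertical (σ t V : ℝ) : ‖cexp ((σ + t * I) * V)‖ = Real.exp (σ * V) := by
  rw [norm_exp]; simp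

lemma integrable_LSeries_mul {f : ℕ → ℂ} (hf : ∀ n, n ≠ 0 → ‖f n‖ ≤ 1) {σ : ℝ} (hσ : 0 < σ)
    (V : ℝ) :
    Integrable fun t : ℝ => LSeries f (1 + (σ + t * I)) * (cexp ((σ + t * I) * V) / (σ + t * I) ^ 2) := by
  have hi := (integrable_one_div_sq hσ).norm.const_mul ((2 + 1 / σ) * Real.exp (σ * V))
  refine hi.mono' ?_ (Filter.Eventually.of_forall fun t => ?_)
  · refine ((continuous_LSeries_vertical hf hσ).mul (Continuous.div (by fun_prop) (by fun_prop)
      fun t => pow_ne_zero 2 (ofReal_add_mul_I_ne_zero hσ t))).aestronglyMeasurable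
  · have h := norm_LSeries_le hf (s := (σ : ℂ) + t * I) (by simpa using hσ)
    have e : ((σ : ℂ) + t * I).re = σ := by simp
    rw [e] at h
    rw [norm_mul, norm_div, norm_cexp_vertical, norm_div, norm_one, div_eq_mul_one_div (Real.exp _),
      mul_assoc]
    gcongr

lemma hasSum_ramp {f : ℕ → ℂ} (hf : ∀ n, n ≠ 0 → ‖f n‖ ≤ 1) {σ : ℝ} (hσ : 0 < σ) (V : ℝ) :
    HasSum (fun n : ℕ => f n / n * (2 * Real.pi * (max (V - Real.log n) 0 : ℝ)))
      (∫ t : ℝ, LSeries f (1 + (σ + t * I)) * (cexp ((σ + t * I) * V) / (σ + t * I) ^ 2)) := by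
  have hterm : ∀ n : ℕ, ∀ t : ℝ,
      LSeries.term f (1 + (σ + t * I)) n * (cexp ((σ + t * I) * V) / (σ + t * I) ^ 2)
        = f n / n * (cexp ((σ + t * I) * (V - Real.log n : ℝ)) / (σ + t * I) ^ 2) := by
    intro n t
    rcases eq_or_ne n 0 with rfl | hn
    · simp
    · have hn' : (n : ℂ) ≠ 0 := by exact_mod_cast hn
      rw [LSeries.term_of_ne_zero hn, cpow_add _ _ hn', cpow_one, cpow_def_of_ne_zero hn',
        natCast_log.symm, show ((σ : ℂ) + t * I) * ((V - Real.log n : ℝ) : ℂ)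
          = (σ + t * I) * V - Real.log n * (σ + t * I) by push_cast; ring, Complex.exp_sub]
      have := Complex.exp_ne_zero (Real.log n * (σ + t * I))
      have := ofReal_add_mul_I_ne_zero hσ t
      field_simp
  have hintegral : ∀ n : ℕ, Integrable fun t : ℝ =>
      LSeries.term f (1 + (σ + t * I)) n * (cexp ((σ + t * I) * V) / (σ + t * I) ^ 2) := by
    intro n
    simp_rw [hterm]
    refine Integrable.const_mul ?_ _
    have hi := (integrable_one_div_sq hσ).norm.const_mul (Real.exp (σ * (V - Real.log n)))
    refine hi.mono' ?_ (Filter.Eventually.of_forall fun t => ?_)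
    · exact (Continuous.div (by fun_prop) (by fun_prop)
        fun t => pow_ne_zero 2 (ofReal_add_mul_I_ne_zero hσ t)).aestronglyMeasurable
    · rw [norm_div, norm_cexp_vertical, norm_div, norm_one, div_eq_mul_one_div (Real.exp _)]
  have hsum : Summable fun n : ℕ => ∫ t : ℝ,
      ‖LSeries.term f (1 + (σ + t * I)) n * (cexp ((σ + t * I) * V) / (σ + t * I) ^ 2)‖ := by
    have h1 : Summable fun n : ℕ => ‖LSeries.term f (1 + (σ : ℂ)) n‖ := by
      refine (LSeriesSummable_of_bounded_of_one_lt_re hf (by simpa using hσ)).norm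
    have h2 := h1.mul_right (∫ t : ℝ, ‖cexp ((σ + t * I) * V) / (σ + t * I) ^ 2‖)
    refine h2.congr fun n => ?_
    rw [← integral_const_mul]
    congr 1
    ext t
    rw [norm_mul, LSeries.norm_term_eq, LSeries.norm_term_eq]
    simp
  have h := hasSum_integral_of_summable_integral_norm hintegral hsum
  have e1 : ∀ n : ℕ, f n / n * (2 * Real.pi * (max (V - Real.log n) 0 : ℝ)) = ∫ t : ℝ,
      LSeries.term f (1 + (σ + t * I)) n * (cexp ((σ + t * I) * V) / (σ + t * I) ^ 2) := by
    intro n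
    simp_rw [hterm, integral_const_mul, integral_exp_div_sq hσ]
  simp_rw [e1, LSeries, ← tsum_mul_right]
  exact h

lemma norm_liouville (n : ℕ) : ‖((-1 : ℂ)) ^ (ArithmeticFunction.cardFactors n)‖ = 1 := by simp

lemma LSeries_liouville_mul_riemannZeta {s : ℂ} (hs : 1 < s.re) :
    LSeries (fun n => (-1 : ℂ) ^ (ArithmeticFunction.cardFactors n)) s * riemannZeta s
      = riemannZeta (2 * s) := by
  have hs0 : s ≠ 0 := by rintro rfl; simp at hs; linarith
  let φ : ℕ →*₀ ℂ :=
    { toFun := fun n => if n = 0 then 0 else (-1) ^ (ArithmeticFunction.cardFactors n) * (n : ℂ) ^ (-s)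
      map_zero' := by simp
      map_one' := by simp
      map_mul' := by
        intro m n
        rcases eq_or_ne m 0 with rfl | hm
        · simp
        rcases eq_or_ne n 0 with rfl | hn
        · simp
        rw [if_neg hm, if_neg hn, if_neg (mul_ne_zero hm hn),
          ArithmeticFunction.cardFactors_mul hm hn, Nat.cast_mul, natCast_mul_natCast_cpow, pow_add]
        ring }
  have hφ : ∀ n, φ n = LSeries.term (fun n => (-1 : ℂ) ^ (ArithmeticFunction.cardFactors n)) s n := by
    intro n
    rw [LSeries.term_def]
    change (if n = 0 then 0 else _) = _
    split_ifs
    · rfl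
    · rw [cpow_neg, div_eq_mul_inv]
  have hsum : Summable fun n => ‖φ n‖ := by
    simp_rw [hφ]
    exact (LSeriesSummable_of_bounded_of_one_lt_re (fun n _ => (norm_liouville n).le) hs).norm
  have h1 := EulerProduct.eulerProduct_completely_multiplicative_hasProd hsum
  have h2 := riemannZeta_eulerProduct_hasProd hs
  have h3 := riemannZeta_eulerProduct_hasProd (s := 2 * s) (by simp; linarith)
  have h4 := h1.mul h2
  rw [tsum_congr hφ] at h4
  refine h4.unique ?_
  convert h3 using 2 with p
  have hp : (p : ℕ) ≠ 0 := p.prop.ne_zero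
  have e1 : φ p = -((p : ℕ) : ℂ) ^ (-s) := by
    change (if (p : ℕ) = 0 then 0 else _) = _
    rw [if_neg hp, ArithmeticFunction.cardFactors_apply_prime p.prop]
    ring
  have e2 : ((p : ℕ) : ℂ) ^ (-(2 * s)) = (((p : ℕ) : ℂ) ^ (-s)) ^ 2 := by
    rw [← cpow_nat_mul]; congr 1; push_cast; ring
  rw [e1, e2, ← mul_inv]
  congr 1
  ring

/-- The function `F(s) / s`, where `F(s) = ∑ λ(n) n^{-1-s}`, continued to the left. -/
noncomputable def liouvilleQuotient (s : ℂ) : ℂ := riemannZeta (2 + 2 * s) * (shiftedZeta s)⁻¹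

lemma LSeries_liouville_eq {s : ℂ} (hs : 0 < s.re) :
    LSeries (fun n => (-1 : ℂ) ^ (ArithmeticFunction.cardFactors n)) (1 + s)
      = s * liouvilleQuotient s := by
  have hs0 : s ≠ 0 := by rintro rfl; simp at hs
  have h1 : 1 < (1 + s).re := by simpa using hs
  have h := LSeries_liouville_mul_riemannZeta h1
  have hζ : riemannZeta (1 + s) ≠ 0 := riemannZeta_ne_zero_of_one_le_re h1.le
  rw [liouvilleQuotient, shiftedZeta_apply hs0, show 2 + 2 * s = 2 * (1 + s) by ring, ← h]
  field_simp

end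

section

open Complex Set MeasureTheory

lemma abs_liouville (n : ℕ) : |liouville n| = 1 := by
  simp [liouville]

lemma ofReal_liouville (n : ℕ) :
    ((liouville n : ℝ) : ℂ) = (-1) ^ (ArithmeticFunction.cardFactors n) := by
  simp [liouville]

lemma card_Ioc_floor_le {V h : ℝ} (hh : 0 < h) (hh1 : h ≤ 1) :
    ((⌊Real.exp (V + h)⌋₊ - ⌊Real.exp V⌋₊ : ℕ) : ℝ) ≤ Real.exp V * (2 * h) + 1 := by
  have hmono : ⌊Real.exp V⌋₊ ≤ ⌊Real.exp (V + h)⌋₊ :=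
    Nat.floor_mono (Real.exp_le_exp.mpr (by linarith))
  rw [Nat.cast_sub hmono]
  have h1 := Nat.floor_le (Real.exp_pos (V + h)).le
  have h2 := Nat.lt_floor_add_one (Real.exp V)
  have h3 := Real.abs_exp_sub_one_le (x := h) (by rw [abs_of_pos hh]; exact hh1)
  rw [abs_of_pos hh] at h3
  have h4 := (abs_le.mp h3).2
  have h5 := mul_le_mul_of_nonneg_left h4 (Real.exp_pos V).le
  have h6 := Real.exp_add V h
  linarith

/-- Comparison of a partial sum with its smoothed version. -/
lemma abs_hasSum_ramp_sub_le {V h : ℝ} (hh : 0 < h) (hh1 : h ≤ 1) {J : ℝ}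
    (hJ : HasSum (fun n : ℕ => liouville n / n *
      (max (V + h - Real.log n) 0 - max (V - Real.log n) 0)) J) :
    |J - h * ∑ n ∈ Finset.Icc 1 ⌊Real.exp V⌋₊, liouville n / n|
      ≤ h * (2 * h + Real.exp (-V)) := by
  set m := ⌊Real.exp V⌋₊ with hm
  set N := ⌊Real.exp (V + h)⌋₊ with hN
  have hmN : m ≤ N := Nat.floor_mono (Real.exp_le_exp.mpr (by linarith))
  have hJ' := hJ.unique (hasSum_sum_of_ne_finset_zero (s := Finset.Ioc 0 N) fun n hn => by
    rcases Nat.eq_zero_or_pos n with rfl | hn0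
    · simp
    · have hnN : N < n := by
        by_contra hc
        exact hn (Finset.mem_Ioc.mpr ⟨hn0, not_lt.mp hc⟩)
      have hlt : V + h < Real.log n := by
        rw [Real.lt_log_iff_exp_lt (by positivity)]
        exact (Nat.floor_lt (Real.exp_pos _).le).mp hnN
      rw [max_eq_right (by linarith), max_eq_right (by linarith), sub_zero, mul_zero])
  have hsplit := Finset.sum_Ioc_consecutive (fun n : ℕ => liouville n / n *
      (max (V + h - Real.log n) 0 - max (V - Real.log n) 0)) (Nat.zero_le m) hmN
  have hfirst : ∑ n ∈ Finset.Ioc 0 m, liouville n / n *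
      (max (V + h - Real.log n) 0 - max (V - Real.log n) 0)
      = h * ∑ n ∈ Finset.Icc 1 m, liouville n / n := by
    rw [Finset.mul_sum]
    refine Finset.sum_congr rfl fun n hn => ?_
    obtain ⟨hn0, hnm⟩ := Finset.mem_Ioc.mp hn
    have hle : Real.log n ≤ V := by
      rw [Real.log_le_iff_le_exp (by positivity)]
      exact (Nat.le_floor_iff (Real.exp_pos _).le).mp hnm
    rw [max_eq_left (by linarith), max_eq_left (by linarith)]
    ring
  rw [hJ', ← hsplit, hfirst, add_sub_cancel_left]
  calc |∑ n ∈ Finset.Ioc m N, liouville n / n *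
        (max (V + h - Real.log n) 0 - max (V - Real.log n) 0)|
      ≤ ∑ n ∈ Finset.Ioc m N, Real.exp (-V) * h := by
        refine (Finset.abs_sum_le_sum_abs _ _).trans (Finset.sum_le_sum fun n hn => ?_)
        obtain ⟨hnm, -⟩ := Finset.mem_Ioc.mp hn
        have hlt : Real.exp V < n := (Nat.floor_lt (Real.exp_pos _).le).mp hnm
        rw [abs_mul, abs_div, abs_liouville, Real.exp_neg, Nat.abs_cast, one_div]
        gcongr
        rw [abs_le]
        constructor <;> rcases max_cases (V + h - Real.log n) 0 with h1 | h1 <;>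
          rcases max_cases (V - Real.log n) 0 with h2 | h2 <;> linarith
    _ = ((N - m : ℕ) : ℝ) * (Real.exp (-V) * h) := by
        rw [Finset.sum_const, Nat.card_Ioc, nsmul_eq_mul]
    _ ≤ (Real.exp V * (2 * h) + 1) * (Real.exp (-V) * h) := by
        gcongr
        exact card_Ioc_floor_le hh hh1
    _ = h * (2 * h + Real.exp (-V)) := by
        have : Real.exp V * Real.exp (-V) = 1 := by rw [← Real.exp_add]; simp
        linear_combination 2 * h * h * this

/-- The entire function `(exp (h s) - 1) / s`. -/
noncomputable def expQuotient (h : ℝ) : ℂ → ℂ := dslope (fun s => cexp (h * s)) 0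

lemma differentiable_expQuotient (h : ℝ) : Differentiable ℂ (expQuotient h) := by
  rw [← differentiableOn_univ, expQuotient, differentiableOn_dslope Filter.univ_mem,
    differentiableOn_univ]
  fun_prop

lemma expQuotient_apply (h : ℝ) {s : ℂ} (hs : s ≠ 0) :
    expQuotient h s = (cexp (h * s) - 1) / s := by
  rw [expQuotient, dslope_of_ne _ hs, slope_def_field]
  simp

lemma norm_expQuotient_le {h : ℝ} (hh : 0 < h) (hh1 : h ≤ 1) {s : ℂ} (hs : s.re ≤ 1) :
    ‖expQuotient h s‖ ≤ 8 / (1 + ‖s‖) := by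
  rcases eq_or_ne s 0 with rfl | hs0
  · rw [expQuotient, dslope_same]
    have : deriv (fun s : ℂ => cexp (h * s)) 0 = h := by
      have := (((hasDerivAt_id' (0 : ℂ)).const_mul (h : ℂ)).cexp).deriv
      simpa using this
    rw [this, norm_real, Real.norm_eq_abs, abs_of_pos hh]
    norm_num
    linarith
  have hpos : 0 < ‖s‖ := norm_pos_iff.mpr hs0
  rw [expQuotient_apply h hs0, norm_div, div_le_div_iff₀ hpos (by positivity)]
  have hhs : ‖(h : ℂ) * s‖ = h * ‖s‖ := by
    rw [norm_mul, norm_real, Real.norm_eq_abs, abs_of_pos hh]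
  have hle : h * ‖s‖ ≤ ‖s‖ := mul_le_of_le_one_left hpos.le hh1
  rcases le_total ‖s‖ 1 with h1 | h1
  · have := norm_exp_sub_one_le (x := (h : ℂ) * s) (by rw [hhs]; linarith)
    rw [hhs] at this
    nlinarith
  · have h2 : ‖cexp (h * s) - 1‖ ≤ 4 := by
      refine (norm_sub_le _ _).trans ?_
      rw [norm_exp, norm_one, re_ofReal_mul]
      have : Real.exp (h * s.re) ≤ Real.exp 1 := Real.exp_le_exp.mpr (by nlinarith)
      linarith [Real.exp_one_lt_d9]
    nlinarith

/-- The integrand of the smoothed Perron formula for `∑ λ(n) / n`. -/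
noncomputable def perronIntegrand (V h : ℝ) (s : ℂ) : ℂ :=
  liouvilleQuotient s * (cexp (s * V) * expQuotient h s)

lemma perronIntegrand_eq {V h σ : ℝ} (hσ : 0 < σ) (t : ℝ) :
    perronIntegrand V h (σ + t * I) =
      LSeries (fun n => (-1 : ℂ) ^ (ArithmeticFunction.cardFactors n)) (1 + (σ + t * I)) *
          (cexp ((σ + t * I) * (V + h : ℝ)) / (σ + t * I) ^ 2)
        - LSeries (fun n => (-1 : ℂ) ^ (ArithmeticFunction.cardFactors n)) (1 + (σ + t * I)) *
          (cexp ((σ + t * I) * V) / (σ + t * I) ^ 2) := by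
  have hs0 := ofReal_add_mul_I_ne_zero hσ t
  rw [LSeries_liouville_eq (by simpa using hσ), perronIntegrand, expQuotient_apply h hs0,
    ofReal_add]
  generalize (σ : ℂ) + t * I = s at hs0 ⊢
  rw [mul_add, Complex.exp_add, mul_comm (h : ℂ)]
  field_simp

lemma integrable_perronIntegrand (V h : ℝ) {σ : ℝ} (hσ : 0 < σ) :
    Integrable fun t : ℝ => perronIntegrand V h (σ + t * I) := by
  simp_rw [perronIntegrand_eq hσ]
  exact (integrable_LSeries_mul (fun n _ => (norm_liouville n).le) hσ _).sub
    (integrable_LSeries_mul (fun n _ => (norm_liouville n).le) hσ _)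

lemma abs_sum_liouville_le {V h σ : ℝ} (hh : 0 < h) (hh1 : h ≤ 1) (hσ : 0 < σ) :
    |∑ n ∈ Finset.Icc 1 ⌊Real.exp V⌋₊, liouville n / n|
      ≤ ‖∫ t : ℝ, perronIntegrand V h (σ + t * I)‖ / h + (2 * h + Real.exp (-V)) := by
  set S := ∑ n ∈ Finset.Icc 1 ⌊Real.exp V⌋₊, liouville n / n with hS
  have hf : ∀ n : ℕ, n ≠ 0 → ‖((-1 : ℂ)) ^ (ArithmeticFunction.cardFactors n)‖ ≤ 1 :=
    fun n _ => (norm_liouville n).le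
  set P := ∫ t : ℝ, perronIntegrand V h (σ + t * I) with hP
  have h1 := (hasSum_ramp hf hσ (V + h)).sub (hasSum_ramp hf hσ V)
  rw [← integral_sub (integrable_LSeries_mul hf hσ _) (integrable_LSeries_mul hf hσ _)] at h1
  simp_rw [← perronIntegrand_eq hσ] at h1
  have h2 : HasSum (fun n : ℕ => liouville n / n *
      (max (V + h - Real.log n) 0 - max (V - Real.log n) 0)) (P.re / (2 * Real.pi)) := by
    have e : ∀ n : ℕ, liouville n / n * (max (V + h - Real.log n) 0 - max (V - Real.log n) 0)
        = reCLM ((-1) ^ ArithmeticFunction.cardFactors n / n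
            * (2 * Real.pi * (max (V + h - Real.log n) 0 : ℝ))
          - (-1) ^ ArithmeticFunction.cardFactors n / n
            * (2 * Real.pi * (max (V - Real.log n) 0 : ℝ))) / (2 * Real.pi) := by
      intro n
      rw [← ofReal_liouville, reCLM_apply]
      norm_cast
      field_simp
    simp_rw [e]
    exact (h1.mapL reCLM).div_const (2 * Real.pi)
  have h3 := abs_hasSum_ramp_sub_le hh hh1 h2
  have h4 : |P.re / (2 * Real.pi)| ≤ ‖P‖ := by
    rw [abs_div, abs_of_pos (by positivity : 0 < 2 * Real.pi)]
    refine (div_le_self (abs_nonneg _) ?_).trans (abs_re_le_norm P)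
    linarith [Real.pi_gt_three]
  have h5 : h * |S| ≤ ‖P‖ + h * (2 * h + Real.exp (-V)) := by
    rw [← abs_of_pos hh, ← abs_mul, abs_of_pos hh]
    have := abs_sub_abs_le_abs_sub (h * S) (P.re / (2 * Real.pi))
    rw [abs_sub_comm] at this
    linarith
  rw [← mul_le_mul_iff_right₀ hh]
  refine h5.trans (le_of_eq ?_)
  field_simp

end

section

open Complex Set MeasureTheory

lemma norm_integral_sub_intervalIntegral_le {f : ℝ → ℂ} (hf : Integrable f) {B T : ℝ} (hT : 0 < T)
    (hB : ∀ t, T ≤ |t| → ‖f t‖ ≤ B / t ^ 2) :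
    ‖(∫ t, f t) - ∫ t in (-T)..T, f t‖ ≤ 2 * B / T := by
  have hIoi : ∀ g : ℝ → ℂ, (∀ t, T ≤ t → ‖g t‖ ≤ B / t ^ 2) → ‖∫ t in Ioi T, g t‖ ≤ B / T := by
    intro g hg
    have h1 : IntegrableOn (fun t : ℝ => B * t ^ (-2 : ℝ)) (Ioi T) :=
      (integrableOn_Ioi_rpow_of_lt (by norm_num) hT).const_mul B
    have h2 : ∫ t in Ioi T, B * t ^ (-2 : ℝ) = B / T := by
      rw [integral_const_mul, integral_Ioi_rpow_of_lt (by norm_num) hT]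
      norm_num
      rw [Real.rpow_neg_one, div_eq_mul_inv]
    rw [← h2]
    refine norm_integral_le_of_norm_le h1 (ae_restrict_of_forall_mem measurableSet_Ioi fun t ht => ?_)
    have ht0 : 0 < t := hT.trans ht
    refine (hg t (le_of_lt ht)).trans (le_of_eq ?_)
    rw [Real.rpow_neg ht0.le, div_eq_mul_inv]
    norm_num
  have e1 : (∫ t, f t) = (∫ t in Iic (-T), f t) + ∫ t in Ioi (-T), f t :=
    (intervalIntegral.integral_Iic_add_Ioi hf.integrableOn hf.integrableOn).symm
  have e2 := intervalIntegral.integral_interval_add_Ioi (a := -T) (b := T)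
    hf.integrableOn hf.integrableOn
  have e3 : (∫ t in Iic (-T), f t) = ∫ t in Ioi T, f (-t) := (integral_comp_neg_Ioi T f).symm
  have e4 : (∫ t, f t) - ∫ t in (-T)..T, f t = (∫ t in Ioi T, f (-t)) + ∫ t in Ioi T, f t := by
    rw [e1, ← e2, e3]; ring
  rw [e4]
  have b1 := hIoi (fun t => f (-t)) fun t ht => by
    simpa using hB (-t) (by rw [abs_neg]; exact ht.trans (le_abs_self t))
  have b2 := hIoi f fun t ht => hB t (ht.trans (le_abs_self t))
  refine (norm_add_le _ _).trans ((add_le_add b1 b2).trans (le_of_eq ?_))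
  ring

lemma norm_liouvilleQuotient_le {s : ℂ} (hs : -(1 / 80) ≤ s.re) {C : ℝ}
    (hC : ‖(shiftedZeta s)⁻¹‖ ≤ C) : ‖liouvilleQuotient s‖ ≤ 4 * C := by
  have h1 : 1 < (2 + 2 * s).re := by simp; linarith
  have h2 : ‖riemannZeta (2 + 2 * s)‖ ≤ 4 := by
    have h3 := norm_LSeries_le (f := 1) (fun n _ => by simp) (s := 1 + 2 * s) (by simp; linarith)
    have e : (1 : ℂ) + (1 + 2 * s) = 2 + 2 * s := by ring
    rw [e, LSeries_one_eq_riemannZeta h1] at h3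
    refine h3.trans ?_
    have h4 : 1 / (1 + 2 * s).re ≤ 2 := by
      rw [div_le_iff₀ (by simp; linarith)]
      simp; linarith
    linarith
  rw [liouvilleQuotient, norm_mul]
  gcongr

lemma norm_perronIntegrand_le {V h C : ℝ} (hh : 0 < h) (hh1 : h ≤ 1) {s : ℂ}
    (hs : -(1 / 80) ≤ s.re) (hs1 : s.re ≤ 1) (hC0 : 0 < C) (hC : ‖(shiftedZeta s)⁻¹‖ ≤ C) :
    ‖perronIntegrand V h s‖ ≤ 32 * C * Real.exp (V * s.re) / (1 + ‖s‖) := by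
  rw [perronIntegrand, norm_mul, norm_mul]
  have e : ‖cexp (s * V)‖ = Real.exp (V * s.re) := by
    rw [norm_exp, mul_comm, re_ofReal_mul]
  rw [e]
  calc ‖liouvilleQuotient s‖ * (Real.exp (V * s.re) * ‖expQuotient h s‖)
      ≤ (4 * C) * (Real.exp (V * s.re) * (8 / (1 + ‖s‖))) := by
        gcongr
        · exact norm_liouvilleQuotient_le hs hC
        · exact norm_expQuotient_le hh hh1 hs1
    _ = _ := by ring

lemma differentiableAt_perronIntegrand (V h : ℝ) {s : ℂ} (hs : -(1 / 80) ≤ s.re)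
    (hZ : shiftedZeta s ≠ 0) : DifferentiableAt ℂ (perronIntegrand V h) s := by
  have h1 : DifferentiableAt ℂ (fun s => riemannZeta (2 + 2 * s)) s := by
    refine DifferentiableAt.comp (g := riemannZeta) (f := fun s => 2 + 2 * s) s
      (differentiableAt_riemannZeta fun h => ?_) (by fun_prop)
    have := congrArg re h
    simp at this
    linarith
  have h2 : DifferentiableAt ℂ (fun s => (shiftedZeta s)⁻¹) s :=
    (differentiable_shiftedZeta s).fun_inv hZ
  have h3 : DifferentiableAt ℂ (fun s => cexp (s * V)) s := by fun_prop
  exact (h1.mul h2).mul (h3.mul (differentiable_expQuotient h s))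

lemma norm_perronIntegrand_le_div_sq {V h : ℝ} (hV : 1 ≤ V) (hh : 0 < h) (hh1 : h ≤ 1) {t : ℝ}
    (ht : t ≠ 0) : ‖perronIntegrand V h ((1 / V : ℝ) + t * I)‖ ≤ 72 * V / t ^ 2 := by
  have hσ : 0 < 1 / V := by positivity
  set s : ℂ := (1 / V : ℝ) + t * I with hs
  have hre : s.re = 1 / V := by simp [hs]
  have him : s.im = t := by simp [hs]
  have ht' : 0 < |t| := abs_pos.mpr ht
  have hts : |t| ≤ ‖s‖ := by rw [← him]; exact abs_im_le_norm s
  have hs0 : 0 < ‖s‖ := ht'.trans_le hts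
  have h1 := norm_LSeries_le (fun n _ => (norm_liouville n).le) (s := s) (by rw [hre]; exact hσ)
  rw [LSeries_liouville_eq (by rw [hre]; exact hσ), hre, norm_mul, one_div_one_div] at h1
  have h2 : ‖liouvilleQuotient s‖ ≤ 3 * V / |t| := by
    rw [le_div_iff₀ ht']
    calc ‖liouvilleQuotient s‖ * |t| ≤ ‖liouvilleQuotient s‖ * ‖s‖ := by gcongr
      _ ≤ 3 * V := by linarith
  have h3 := norm_expQuotient_le hh hh1 (s := s) (by
    rw [hre, div_le_one (by linarith)]; exact hV)
  have h4 : ‖cexp (s * V)‖ ≤ 3 := by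
    rw [norm_exp, mul_comm, re_ofReal_mul, hre, mul_one_div_cancel (by linarith)]
    linarith [Real.exp_one_lt_d9]
  rw [perronIntegrand, norm_mul, norm_mul]
  calc ‖liouvilleQuotient s‖ * (‖cexp (s * V)‖ * ‖expQuotient h s‖)
      ≤ (3 * V / |t|) * (3 * (8 / (1 + ‖s‖))) := by gcongr
    _ ≤ (3 * V / |t|) * (3 * (8 / |t|)) := by gcongr; linarith
    _ = 72 * V / t ^ 2 := by rw [← sq_abs t]; field_simp; norm_num

lemma norm_integral_perronIntegrand_le {κ C : ℝ} (hκ : 0 < κ) (hκ1 : κ ≤ 1 / 80) (hC : 0 < C)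
    (hZ : ∀ s : ℂ, -κ / Real.log (|s.im| + 3) ≤ s.re → s.re ≤ 1 →
      shiftedZeta s ≠ 0 ∧ ‖(shiftedZeta s)⁻¹‖ ≤ C)
    {V h T : ℝ} (hV : 1 ≤ V) (hh : 0 < h) (hh1 : h ≤ 1) (hT : 0 < T) :
    ‖∫ t : ℝ, perronIntegrand V h ((1 / V : ℝ) + t * I)‖
      ≤ 144 * V / T + 384 * C / T + 64 * C * T * Real.exp (-(κ / Real.log (T + 3) * V)) := by
  set σ := 1 / V with hσdef
  have hσ : 0 < σ := by positivity
  have hσ1 : σ ≤ 1 := by rw [hσdef, div_le_one (by linarith)]; exact hV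
  have hVσ : V * σ = 1 := by rw [hσdef]; field_simp
  set δ := κ / Real.log (T + 3) with hδdef
  have hLT : 1 ≤ Real.log (T + 3) := by
    have := one_le_log_abs_add_three T
    rwa [abs_of_pos hT] at this
  have hδ : 0 < δ := by positivity
  have hδ1 : δ ≤ 1 / 80 := (div_le_self hκ.le hLT).trans hκ1
  have hreg : ∀ s : ℂ, -δ ≤ s.re → s.re ≤ σ → |s.im| ≤ T →
      shiftedZeta s ≠ 0 ∧ ‖(shiftedZeta s)⁻¹‖ ≤ C := by
    intro s h1 h2 h3
    refine hZ s (le_trans ?_ h1) (h2.trans hσ1)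
    have := one_le_log_abs_add_three s.im
    rw [hδdef, neg_div, neg_le_neg_iff]
    gcongr
  have hbd : ∀ s : ℂ, -δ ≤ s.re → s.re ≤ σ → |s.im| ≤ T →
      ‖perronIntegrand V h s‖ ≤ 32 * C * Real.exp (V * s.re) / (1 + ‖s‖) := fun s h1 h2 h3 =>
    norm_perronIntegrand_le hh hh1 (by linarith) (h2.trans hσ1) hC (hreg s h1 h2 h3).2
  have htail := norm_integral_sub_intervalIntegral_le (integrable_perronIntegrand V h hσ)
    (B := 72 * V) hT fun t ht => norm_perronIntegrand_le_div_sq hV hh hh1 (by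
      rintro rfl; simp at ht; linarith)
  have hrect := Complex.integral_boundary_rect_eq_zero_of_differentiableOn (perronIntegrand V h)
    ⟨-δ, -T⟩ ⟨σ, T⟩ (by
      intro s hs
      obtain ⟨h1, h2⟩ := hs
      simp only [mem_preimage] at h1 h2
      rw [uIcc_of_le (by linarith)] at h1 h2
      exact (differentiableAt_perronIntegrand V h (by linarith [h1.1])
        (hreg s h1.1 h1.2 (abs_le.mpr h2)).1).differentiableWithinAt)
  simp only at hrect
  have hhor : ∀ u : ℝ, |u| = T →
      ‖∫ x in (-δ)..σ, perronIntegrand V h (x + u * I)‖ ≤ 192 * C / T := by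
    intro u hu
    have : ∀ x ∈ uIoc (-δ) σ, ‖perronIntegrand V h (x + u * I)‖ ≤ 96 * C / T := by
      intro x hx
      rw [uIoc_of_le (by linarith)] at hx
      have hre : ((x : ℂ) + u * I).re = x := by simp
      have him : ((x : ℂ) + u * I).im = u := by simp
      have h1 := hbd ((x : ℂ) + u * I) (by rw [hre]; exact hx.1.le) (by rw [hre]; exact hx.2)
        (by rw [him, hu])
      have h2 := abs_im_le_norm ((x : ℂ) + u * I)
      rw [him, hu] at h2
      rw [hre] at h1
      have h3 : Real.exp (V * x) ≤ 3 := by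
        have : V * x ≤ 1 := by rw [← hVσ]; gcongr; exact hx.2
        linarith [Real.exp_le_exp.mpr this, Real.exp_one_lt_d9]
      refine h1.trans ?_
      calc 32 * C * Real.exp (V * x) / (1 + ‖(x : ℂ) + u * I‖) ≤ 32 * C * 3 / T := by
            gcongr; linarith
        _ = 96 * C / T := by ring
    refine (intervalIntegral.norm_integral_le_of_norm_le_const this).trans ?_
    rw [abs_of_pos (by linarith)]
    calc 96 * C / T * (σ - -δ) ≤ 96 * C / T * 2 := by gcongr; linarith
      _ = _ := by ring
  have hleft : ‖∫ y in (-T)..T, perronIntegrand V h ((-δ : ℝ) + y * I)‖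
      ≤ 64 * C * T * Real.exp (-(δ * V)) := by
    have : ∀ y ∈ uIoc (-T) T, ‖perronIntegrand V h ((-δ : ℝ) + y * I)‖
        ≤ 32 * C * Real.exp (-(δ * V)) := by
      intro y hy
      rw [uIoc_of_le (by linarith)] at hy
      have hre : (((-δ : ℝ) : ℂ) + y * I).re = -δ := by simp
      have him : (((-δ : ℝ) : ℂ) + y * I).im = y := by simp
      have h1 := hbd (((-δ : ℝ) : ℂ) + y * I) (by rw [hre]) (by rw [hre]; linarith)
        (by rw [him, abs_le]; exact ⟨hy.1.le, hy.2⟩)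
      rw [hre, show V * -δ = -(δ * V) by ring] at h1
      refine h1.trans (div_le_self (by positivity) ?_)
      linarith [norm_nonneg (((-δ : ℝ) : ℂ) + y * I)]
    refine (intervalIntegral.norm_integral_le_of_norm_le_const this).trans (le_of_eq ?_)
    rw [abs_of_pos (by linarith)]
    ring
  have hmid : ‖∫ y in (-T)..T, perronIntegrand V h (σ + y * I)‖
      ≤ 64 * C * T * Real.exp (-(δ * V)) + 384 * C / T := by
    have e : I • (∫ y in (-T)..T, perronIntegrand V h (σ + y * I))
        = I • (∫ y in (-T)..T, perronIntegrand V h ((-δ : ℝ) + y * I))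
          - (∫ x in (-δ)..σ, perronIntegrand V h (x + (-T : ℝ) * I))
          + ∫ x in (-δ)..σ, perronIntegrand V h (x + (T : ℝ) * I) := by
      linear_combination hrect
    have hn : ∀ z : ℂ, ‖I • z‖ = ‖z‖ := fun z => by simp
    rw [← hn, e]
    refine (norm_add_le _ _).trans ?_
    have h1 := norm_sub_le (I • (∫ y in (-T)..T, perronIntegrand V h ((-δ : ℝ) + y * I)))
      (∫ x in (-δ)..σ, perronIntegrand V h (x + (-T : ℝ) * I))
    rw [hn] at h1
    have h2 := hhor (-T) (by rw [abs_neg, abs_of_pos hT])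
    have h3 := hhor T (abs_of_pos hT)
    have h4 : 384 * C / T = 192 * C / T + 192 * C / T := by ring
    linarith
  have h5 := norm_sub_norm_le (∫ t : ℝ, perronIntegrand V h (σ + t * I))
    (∫ t in (-T)..T, perronIntegrand V h (σ + t * I))
  have h6 : 2 * (72 * V) / T = 144 * V / T := by ring
  linarith

end

lemma perron_error_le {a w C : ℝ} (ha : 0 < a) (ha1 : a ≤ 1) (hC : 0 < C) (hw : 1 ≤ w)
    (haw : 2 ≤ a * w) :
    (144 * w ^ 2 / Real.exp (a * w) + 384 * C / Real.exp (a * w) + 64 * C * Real.exp (a * w) *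
        Real.exp (-(4 * a ^ 2 / Real.log (Real.exp (a * w) + 3) * w ^ 2))) / Real.exp (-(a / 4) * w)
      + (2 * Real.exp (-(a / 4) * w) + Real.exp (-w ^ 2))
      ≤ (144 * (8 / a ^ 2) + 384 * C + 64 * C + 3) * Real.exp (-(a / 4) * w) := by
  set E := Real.exp (-(a / 4) * w) with hE
  have hE0 : 0 < E := Real.exp_pos _
  have hT : Real.exp (a * w) = (E ^ 4)⁻¹ := by
    rw [hE, ← Real.exp_nat_mul, ← Real.exp_neg]
    congr 1
    push_cast
    ring
  have hE1 : E ≤ 1 := Real.exp_le_one_iff.2 (by nlinarith)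
  have hw2 : w ^ 2 ≤ 8 / a ^ 2 / E ^ 2 := by
    have h1 := Real.quadratic_le_exp_of_nonneg (x := a / 2 * w) (by positivity)
    have h2 : Real.exp (a / 2 * w) = (E ^ 2)⁻¹ := by
      rw [hE, ← Real.exp_nat_mul, ← Real.exp_neg]
      congr 1
      push_cast
      ring
    rw [h2] at h1
    rw [div_eq_mul_inv, div_mul_eq_mul_div, le_div_iff₀ (by positivity)]
    nlinarith
  have hlog0 : 0 < Real.log (Real.exp (a * w) + 3) :=
    Real.log_pos (by have := Real.exp_pos (a * w); linarith)
  have hlog : Real.log (Real.exp (a * w) + 3) ≤ 2 * (a * w) := by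
    rw [Real.log_le_iff_le_exp (by positivity), two_mul, Real.exp_add]
    have := Real.add_one_le_exp (a * w)
    nlinarith
  have hdecay : Real.exp (-(4 * a ^ 2 / Real.log (Real.exp (a * w) + 3) * w ^ 2)) ≤ E ^ 8 := by
    rw [hE, ← Real.exp_nat_mul]
    refine Real.exp_le_exp.2 ?_
    have : 2 * (a * w) ≤ 4 * a ^ 2 / Real.log (Real.exp (a * w) + 3) * w ^ 2 := by
      rw [div_mul_eq_mul_div, le_div_iff₀ hlog0]
      nlinarith
    push_cast
    linarith
  have hexp : Real.exp (-w ^ 2) ≤ E := Real.exp_le_exp.2 (by nlinarith)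
  have hmain : 144 * w ^ 2 / Real.exp (a * w) + 384 * C / Real.exp (a * w) +
      64 * C * Real.exp (a * w) *
        Real.exp (-(4 * a ^ 2 / Real.log (Real.exp (a * w) + 3) * w ^ 2))
      ≤ (144 * (8 / a ^ 2) + 384 * C + 64 * C) * E ^ 2 := by
    have hE42 : E ^ 4 ≤ E ^ 2 := pow_le_pow_of_le_one hE0.le hE1 (by norm_num)
    have h1 : 144 * w ^ 2 / Real.exp (a * w) ≤ 144 * (8 / a ^ 2) * E ^ 2 := by
      rw [hT, div_inv_eq_mul]
      calc 144 * w ^ 2 * E ^ 4 ≤ 144 * (8 / a ^ 2 / E ^ 2) * E ^ 4 := by gcongr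
        _ = 144 * (8 / a ^ 2) * E ^ 2 := by field_simp
    have h2 : 384 * C / Real.exp (a * w) ≤ 384 * C * E ^ 2 := by
      rw [hT, div_inv_eq_mul]
      gcongr
    have h3 : 64 * C * Real.exp (a * w) *
        Real.exp (-(4 * a ^ 2 / Real.log (Real.exp (a * w) + 3) * w ^ 2)) ≤ 64 * C * E ^ 2 := by
      refine (mul_le_mul_of_nonneg_left hdecay (by positivity)).trans ?_
      rw [hT]
      calc 64 * C * (E ^ 4)⁻¹ * E ^ 8 = 64 * C * E ^ 4 := by field_simp
        _ ≤ 64 * C * E ^ 2 := by gcongr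
    linarith
  have hquot := div_le_div_of_nonneg_right hmain hE0.le
  have : (144 * (8 / a ^ 2) + 384 * C + 64 * C) * E ^ 2 / E
      = (144 * (8 / a ^ 2) + 384 * C + 64 * C) * E := by field_simp
  linarith

/-- `|∑_{n ≤ x} λ n / n| ≤ C exp(-c √(log x))` for `x ≥ x₀`. -/
theorem liouville_sum_bound :
    ∃ c C x₀ : ℝ, 0 < c ∧ ∀ x : ℝ, x₀ ≤ x →
      |∑ n ∈ Finset.Icc 1 ⌊x⌋₊, liouville n / n|
        ≤ C * Real.exp (-c * Real.sqrt (Real.log x)) := by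
  obtain ⟨κ, C, hκ, hκ1, hC, hZ⟩ := exists_norm_inv_shiftedZeta_le
  set a := √κ / 2 with ha_def
  have ha : 0 < a := by positivity
  have hκa : κ = 4 * a ^ 2 := by
    rw [ha_def, div_pow, Real.sq_sqrt hκ.le]
    ring
  have ha1 : a ≤ 1 := by nlinarith
  refine ⟨a / 4, 144 * (8 / a ^ 2) + 384 * C + 64 * C + 3, Real.exp ((2 / a) ^ 2), by positivity,
    fun x hx => ?_⟩
  have hx0 : 0 < x := (Real.exp_pos _).trans_le hx
  have hV : (2 / a) ^ 2 ≤ Real.log x := (Real.le_log_iff_exp_le hx0).2 hx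
  set w := √(Real.log x)
  have hw : 2 / a ≤ w := Real.le_sqrt_of_sq_le hV
  have hw2 : Real.log x = w ^ 2 := (Real.sq_sqrt ((sq_nonneg _).trans hV)).symm
  have haw : 2 ≤ a * w := by rwa [div_le_iff₀' ha] at hw
  have hw1 : 1 ≤ w := by nlinarith
  have hV1 : 1 ≤ w ^ 2 := by nlinarith
  have hh1 : Real.exp (-(a / 4) * w) ≤ 1 := Real.exp_le_one_iff.2 (by nlinarith)
  have hsum := abs_sum_liouville_le (V := w ^ 2) (Real.exp_pos (-(a / 4) * w)) hh1
    (one_div_pos.2 (zero_lt_one.trans_le hV1))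
  rw [← hw2, Real.exp_log hx0, hw2] at hsum
  have hintegral := norm_integral_perronIntegrand_le hκ hκ1 hC hZ hV1 (Real.exp_pos (-(a / 4) * w)) hh1
    (Real.exp_pos (a * w))
  rw [hκa] at hintegral
  have herr := perron_error_le ha ha1 hC hw1 haw
  have hdiv := div_le_div_of_nonneg_right hintegral (Real.exp_pos (-(a / 4) * w)).le
  linarith
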